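/- arXiv:1706.09018 — 2 statements merged into one kernel-verified Lean document; each statement's English description precedes it below -/
import Mathlib

section
/- Let I be an ideal on a set A, and let θ and λ be regular cardinals with θ⁺⁺ < λ. Suppose f⃗ = ⟨f_ξ : ξ < λ⟩ is a <_I-increasing sequence of functions from A to the ordinals such that for every δ < λ of cofinality θ⁺⁺ there is a club E_δ ⊆ δ and some δ' with δ ≤ δ' < λ such that sup{f_α : α ∈ E_δ} <_I f_{δ'} (the supremum taken pointwise). Then f⃗ satisfies (*)_θ. -/
noncomputable section

namespace PCFPaper

open Set

/-- An ideal on a set `A` of ordinals: a collection of subsets of `A` containing `∅`,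
closed under subsets and finite unions, with `A ∉ I`. -/
structure IsIdealOn (A : Set Ordinal.{0}) (I : Set (Set Ordinal.{0})) : Prop where
  subset_of_mem : ∀ X ∈ I, X ⊆ A
  empty_mem : (∅ : Set Ordinal.{0}) ∈ I
  mem_of_subset : ∀ X ∈ I, ∀ Y, Y ⊆ X → Y ∈ I
  union_mem : ∀ X ∈ I, ∀ Y ∈ I, X ∪ Y ∈ I
  not_mem : A ∉ I

/-- An ultrafilter on the set `A` of ordinals. -/
structure IsUltrafilterOn (A : Set Ordinal.{0}) (D : Set (Set Ordinal.{0})) : Prop where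
  subset_of_mem : ∀ X ∈ D, X ⊆ A
  univ_mem : A ∈ D
  empty_not_mem : (∅ : Set Ordinal.{0}) ∉ D
  superset_mem : ∀ X ∈ D, ∀ Y, X ⊆ Y → Y ⊆ A → Y ∈ D
  inter_mem : ∀ X ∈ D, ∀ Y ∈ D, X ∩ Y ∈ D
  mem_or_compl_mem : ∀ X, X ⊆ A → X ∈ D ∨ A \ X ∈ D

variable (A : Set Ordinal.{0}) (I : Set (Set Ordinal.{0}))

/-- `f <_I g` : the set where `f(a) < g(a)` fails lies in `I`. -/
def ltI (f g : Ordinal.{0} → Ordinal.{0}) : Prop :=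
  {a | a ∈ A ∧ ¬ f a < g a} ∈ I

/-- `f ≤_I g` : the set where `f(a) ≤ g(a)` fails lies in `I`. -/
def leI (f g : Ordinal.{0} → Ordinal.{0}) : Prop :=
  {a | a ∈ A ∧ ¬ f a ≤ g a} ∈ I

/-- `f <_D g` for a filter/ultrafilter `D` : the set where `f(a) < g(a)` lies in `D`. -/
def ltD (f g : Ordinal.{0} → Ordinal.{0}) : Prop :=
  {a | a ∈ A ∧ f a < g a} ∈ I

/-- `f ≤_D g` for a filter/ultrafilter `D`. -/
def leD (f g : Ordinal.{0} → Ordinal.{0}) : Prop :=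
  {a | a ∈ A ∧ f a ≤ g a} ∈ I

/-- `B =_I C` : the symmetric difference lies in `I`. -/
def EqModI (B C : Set Ordinal.{0}) : Prop :=
  (B \ C) ∪ (C \ B) ∈ I

/-- `B` is an `I`-positive subset of `A`. -/
def IsPositive (B : Set Ordinal.{0}) : Prop :=
  B ⊆ A ∧ B ∉ I

/-- `⟨f ξ : ξ < μ⟩` is a `<_I`-increasing sequence of functions. -/
def IncreasingModI (μ : Ordinal.{0}) (f : Ordinal.{0} → Ordinal.{0} → Ordinal.{0}) : Prop :=
  ∀ ξ < μ, ∀ η < μ, ξ < η → ltI A I (f ξ) (f η)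

/-- `g` is an `I`-upper bound of the sequence `⟨f ξ : ξ < μ⟩`. -/
def IsUBseq (μ : Ordinal.{0}) (f : Ordinal.{0} → Ordinal.{0} → Ordinal.{0})
    (g : Ordinal.{0} → Ordinal.{0}) : Prop :=
  ∀ ξ < μ, leI A I (f ξ) g

/-- `g` is an `I`-least upper bound of the sequence `⟨f ξ : ξ < μ⟩`. -/
def IsLUBseq (μ : Ordinal.{0}) (f : Ordinal.{0} → Ordinal.{0} → Ordinal.{0})
    (g : Ordinal.{0} → Ordinal.{0}) : Prop :=
  IsUBseq A I μ f g ∧ ∀ g', IsUBseq A I μ f g' → leI A I g g'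

/-- `g` is an `I`-exact upper bound of the sequence `⟨f ξ : ξ < μ⟩` : a least upper
bound such that the sequence is `<_I`-cofinal below `g`. -/
def IsEUBseq (μ : Ordinal.{0}) (f : Ordinal.{0} → Ordinal.{0} → Ordinal.{0})
    (g : Ordinal.{0} → Ordinal.{0}) : Prop :=
  IsLUBseq A I μ f g ∧ ∀ h : Ordinal.{0} → Ordinal.{0}, ltI A I h g →
    ∃ ξ < μ, leI A I h (f ξ)

/-- `Good_θ` : the sequence has an `I`-exact upper bound `g` with
`{a ∈ A : cf (g a) < θ} ∈ I`. -/
def GoodAt (μ : Ordinal.{0}) (f : Ordinal.{0} → Ordinal.{0} → Ordinal.{0})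
    (θ : Cardinal.{0}) : Prop :=
  ∃ g : Ordinal.{0} → Ordinal.{0}, IsEUBseq A I μ f g ∧
    {a | a ∈ A ∧ Ordinal.cof (g a) < θ} ∈ I

/-- `Bad_θ` : there are sets `S a` of size `< θ` and an ultrafilter `D` disjoint from `I`
such that for each `ξ < μ` some `h ∈ ∏ S a` is sandwiched `f ξ <_D h <_D f η`. -/
def BadAt (μ : Ordinal.{0}) (f : Ordinal.{0} → Ordinal.{0} → Ordinal.{0})
    (θ : Cardinal.{0}) : Prop :=
  ∃ S : Ordinal.{0} → Set Ordinal.{0}, ∃ D : Set (Set Ordinal.{0}),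
    (∀ a ∈ A, Cardinal.mk (S a) < Cardinal.lift.{1} θ) ∧
    IsUltrafilterOn A D ∧ D ∩ I = ∅ ∧
    ∀ ξ < μ, ∃ h : Ordinal.{0} → Ordinal.{0}, (∀ a ∈ A, h a ∈ S a) ∧
      ∃ η < μ, ltD A D (f ξ) h ∧ ltD A D h (f η)

/-- `Ugly` : there is `g : A → ON` such that the sets `t ξ = {a ∈ A : f ξ a > g a}`
do not stabilize modulo `I`. -/
def IsUgly (μ : Ordinal.{0}) (f : Ordinal.{0} → Ordinal.{0} → Ordinal.{0}) : Prop :=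
  ∃ g : Ordinal.{0} → Ordinal.{0}, ∀ ξ < μ, ∃ η, ξ < η ∧ η < μ ∧
    ({a | a ∈ A ∧ g a < f η a} \ {a | a ∈ A ∧ g a < f ξ a}) ∉ I

/-- `I` is `θ`-regular : any `θ`-sequence of `I`-positive sets admits a subfamily of
full size `θ` with nonempty intersection. -/
def ThetaRegular (θ : Cardinal.{0}) : Prop :=
  ∀ As : Ordinal.{0} → Set Ordinal.{0}, (∀ i < θ.ord, IsPositive A I (As i)) →
    ∃ H : Set Ordinal.{0}, H ⊆ Set.Iio θ.ord ∧
      Cardinal.mk H = Cardinal.lift.{1} θ ∧ (⋂ i ∈ H, As i).Nonempty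

/-- `reg I` : the least regular `θ` such that `I` is `θ`-regular. -/
def regI : Cardinal.{0} :=
  sInf {θ : Cardinal.{0} | θ.IsRegular ∧ ThetaRegular A I θ}

/-- `I` is weakly `θ`-saturated : there is no partition of `A` into `θ` many
`I`-positive sets. -/
def WeaklySaturated (θ : Cardinal.{0}) : Prop :=
  ¬ ∃ P : Ordinal.{0} → Set Ordinal.{0},
    (∀ i < θ.ord, IsPositive A I (P i)) ∧
    (∀ i < θ.ord, ∀ j < θ.ord, i ≠ j → Disjoint (P i) (P j)) ∧
    (⋃ i ∈ Set.Iio θ.ord, P i) = A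

/-- `wsat I` : the least `θ` such that `I` is weakly `θ`-saturated. -/
def wsat : Cardinal.{0} :=
  sInf {θ : Cardinal.{0} | WeaklySaturated A I θ}

/-- `I` is `θ`-indecomposable : closed under unions of `⊆`-increasing chains of
length `θ`. -/
def Indecomposable (θ : Cardinal.{0}) : Prop :=
  ∀ B : Ordinal.{0} → Set Ordinal.{0},
    (∀ i < θ.ord, B i ∈ I) →
    (∀ i < θ.ord, ∀ j < θ.ord, i ≤ j → B i ⊆ B j) →
    (⋃ i ∈ Set.Iio θ.ord, B i) ∈ I

/-- `⟨f ξ : ξ ∈ X⟩` is strongly increasing : there are sets `Z ξ ∈ I` witnessing the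
increase everywhere outside of them. -/
def StronglyIncreasing (X : Set Ordinal.{0})
    (f : Ordinal.{0} → Ordinal.{0} → Ordinal.{0}) : Prop :=
  ∃ Z : Ordinal.{0} → Set Ordinal.{0}, (∀ ξ ∈ X, Z ξ ∈ I) ∧
    ∀ η ∈ X, ∀ ξ ∈ X, η < ξ → ∀ a ∈ A \ (Z η ∪ Z ξ), f η a < f ξ a

/-- `(*)_θ` : every unbounded `X ⊆ μ` has a subset of size `θ` on which the sequence is
strongly increasing. -/
def Star (μ : Ordinal.{0}) (θ : Cardinal.{0})
    (f : Ordinal.{0} → Ordinal.{0} → Ordinal.{0}) : Prop :=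
  ∀ X : Set Ordinal.{0}, X ⊆ Set.Iio μ → (∀ α < μ, ∃ ξ ∈ X, α ≤ ξ) →
    ∃ X₀, X₀ ⊆ X ∧ Cardinal.mk X₀ = Cardinal.lift.{1} θ ∧
      StronglyIncreasing A I X₀ f

/-- `E` is a club (closed unbounded) subset of `δ`. -/
def IsClubIn (E : Set Ordinal.{0}) (δ : Ordinal.{0}) : Prop :=
  E ⊆ Set.Iio δ ∧ (∀ α < δ, ∃ β ∈ E, α ≤ β) ∧
  (∀ β < δ, β ≠ 0 → (∀ γ < β, ∃ ε ∈ E, γ < ε ∧ ε < β) → β ∈ E)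

/-- `A` is a set of regular cardinals. -/
def IsRegularCardSet : Prop :=
  ∀ a ∈ A, ∃ c : Cardinal.{0}, c.IsRegular ∧ c.ord = a

/-- `∏ A` : the set of functions `f` with `f a ∈ a` for every `a ∈ A`. -/
def prodSet : Set (Ordinal.{0} → Ordinal.{0}) :=
  {f | ∀ a ∈ A, f a < a}

/-- `(∏ A, ≤_J)` is `λ`-directed : every subset of `∏ A` of cardinality `< λ` has a
`≤_J`-upper bound in `∏ A`. -/
def DirectedMod (lam : Cardinal.{0}) : Prop :=
  ∀ F : Set (Ordinal.{0} → Ordinal.{0}), F ⊆ prodSet A →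
    Cardinal.mk F < Cardinal.lift.{1} lam →
    ∃ g ∈ prodSet A, ∀ f ∈ F, leI A I f g

/-- `cf (∏ A / D)` : the least cardinality of a cofinal subfamily of `∏ A` modulo `D`. -/
def cfProd (D : Set (Set Ordinal.{0})) : Cardinal.{0} :=
  sInf {c : Cardinal.{0} | ∃ F : Ordinal.{0} → Ordinal.{0} → Ordinal.{0},
    (∀ i < c.ord, F i ∈ prodSet A) ∧
    ∀ g ∈ prodSet A, ∃ i < c.ord, leD A D g (F i)}

/-- `pcf_I (A)` : the set of cofinalities `cf (∏ A / D)` for ultrafilters `D` on `A`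
disjoint from `I`. -/
def pcf : Set Cardinal.{0} :=
  {c | ∃ D, IsUltrafilterOn A D ∧ D ∩ I = ∅ ∧ cfProd A D = c}

/-- The ideal `J_{<λ}^I [A]`. -/
def Jlt (lam : Cardinal.{0}) : Set (Set Ordinal.{0}) :=
  {B | B ⊆ A ∧ (B ∈ I ∨
    ∀ D, IsUltrafilterOn A D → D ∩ I = ∅ → B ∈ D → cfProd A D < lam)}

/-- The ideal generated by `J ∪ {B}` (on subsets of `A`). -/
def generatedBy (J : Set (Set Ordinal.{0})) (B : Set Ordinal.{0}) :
    Set (Set Ordinal.{0}) :=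
  {X | X ⊆ A ∧ ∃ Y ∈ J, X ⊆ Y ∪ B}

/-- `cf (∏ A / I)` : least cardinality of a `≤_I`-cofinal subfamily of `∏ A`. -/
def cfProdI : Cardinal.{0} :=
  sInf {c : Cardinal.{0} | ∃ F : Ordinal.{0} → Ordinal.{0} → Ordinal.{0},
    (∀ i < c.ord, F i ∈ prodSet A) ∧
    ∀ g ∈ prodSet A, ∃ i < c.ord, leI A I g (F i)}

/-- A universal cofinal sequence for `λ ∈ pcf_I (A)`. -/
def IsUniversalSequence (lam : Cardinal.{0})
    (f : Ordinal.{0} → Ordinal.{0} → Ordinal.{0}) : Prop :=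
  (∀ ξ < lam.ord, f ξ ∈ prodSet A) ∧
  IncreasingModI A (Jlt A I lam) lam.ord f ∧
  ∀ D, IsUltrafilterOn A D → D ∩ I = ∅ → cfProd A D = lam →
    ∀ g ∈ prodSet A, ∃ ξ < lam.ord, leD A D g (f ξ)

universe u

/-- Transfinite recursion along a well-order, for set- or ordinal-valued functions defined from
their restriction to proper initial segments. -/
theorem exists_wellFounded_rec {W : Type*} [LinearOrder W] [WellFoundedLT W] {β : Type*}
    [Inhabited β]
    (Ψ : (W → β) → W → β)
    (hΨ : ∀ r r' w, (∀ v < w, r v = r' v) → Ψ r w = Ψ r' w) :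
    ∃ r : W → β, ∀ w, r w = Ψ r w := by
  classical
  let r : W → β := (wellFounded_lt (α := W)).fix fun w ih =>
    Ψ (fun v => if h : v < w then ih v h else default) w
  refine ⟨r, fun w => ?_⟩
  have h : r w = Ψ (fun v => if v < w then r v else default) w := by
    have := (wellFounded_lt (α := W)).fix_eq
      (fun w ih => Ψ (fun v => if h : v < w then ih v h else default) w) w
    simp only [dite_eq_ite] at this
    exact this
  rw [h]
  exact hΨ _ _ _ fun v hv => if_pos hv

/-- A family indexed by fewer than `cof W` elements is strictly bounded. -/
theorem exists_forall_lt_of_mk_lt_cof {W ι : Type u} [LinearOrder W]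
    (g : ι → W) (h : Cardinal.mk ι < Order.cof W) : ∃ w, ∀ i, g i < w := by
  by_contra! H
  refine ((Order.cof_le (s := Set.range g) fun w => ?_).trans Cardinal.mk_range_le).not_gt h
  obtain ⟨i, hi⟩ := H w
  exact ⟨_, ⟨i, rfl⟩, hi⟩

/-- If `e` is strictly increasing and interleaved with `T`, then `T` is at least as large as the
cofinality of the domain of `e`. -/
theorem cof_le_mk_of_interleaved {L W : Type u} [LinearOrder L] [LinearOrder W] {e : L → W}
    (he : StrictMono e) {T : Set W} (h₁ : ∀ i, ∃ t ∈ T, e i ≤ t) (h₂ : ∀ t ∈ T, ∃ i, t < e i) :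
    Order.cof L ≤ Cardinal.mk T := by
  choose g hg using fun t : T => h₂ t t.2
  refine (Order.cof_le (s := Set.range g) fun i => ?_).trans Cardinal.mk_range_le
  obtain ⟨t, ht, hit⟩ := h₁ i
  exact ⟨_, ⟨⟨t, ht⟩, rfl⟩, (he.lt_iff_lt.1 (hit.trans_lt (hg ⟨t, ht⟩))).le⟩

theorem noMaxOrder_of_aleph0_le_cof {W : Type u} [LinearOrder W]
    (h : Cardinal.aleph0 ≤ Order.cof W) : NoMaxOrder W := by
  have : Nonempty W := Order.cof_ne_zero_iff.1 fun h0 =>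
    Cardinal.aleph0_ne_zero (le_zero_iff.1 (h0 ▸ h))
  have := Order.one_lt_cof_iff.1 (Cardinal.one_lt_aleph0.trans_le h)
  exact NoTopOrder.to_noMaxOrder W

/-- The projection of `γ` to `E`: the largest element of the closed set `E` below `γ`. -/
def glue {W : Type u} [ConditionallyCompleteLinearOrderBot W] (E : Set W) (γ : W) : W :=
  sSup {x | x ∈ E ∧ x ≤ γ}

section Glue

variable {W : Type u} [ConditionallyCompleteLinearOrderBot W]

theorem bddAbove_sep_le (E : Set W) (γ : W) : BddAbove {x | x ∈ E ∧ x ≤ γ} :=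
  ⟨γ, fun _ hx => hx.2⟩

theorem glue_le (E : Set W) (γ : W) : glue E γ ≤ γ :=
  csSup_le' fun _ hx => hx.2

theorem le_glue {E : Set W} {x γ : W} (hx : x ∈ E) (h : x ≤ γ) : x ≤ glue E γ :=
  le_csSup (bddAbove_sep_le E γ) ⟨hx, h⟩

theorem glue_mono {E F : Set W} (h : E ⊆ F) (γ : W) : glue E γ ≤ glue F γ :=
  csSup_le_csSup' (bddAbove_sep_le F γ) fun _ hx => ⟨h hx.1, hx.2⟩

theorem glue_mem {E D : Set W} (hD : IsClub D) (h : E ⊆ D) {γ : W} (hγ : glue E γ ≠ ⊥) :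
    glue E γ ∈ D := by
  refine hD.csSup_mem (fun x hx => h hx.1) ?_ (bddAbove_sep_le E γ)
  by_contra hne
  rw [Set.not_nonempty_iff_eq_empty] at hne
  exact hγ (by rw [glue, hne, csSup_empty])

end Glue

/-- A decreasing sequence of length `> θ` of functions on a set of size `≤ θ` stabilizes. -/
theorem exists_stable {K W : Type u} [LinearOrder K] [LinearOrder W] [WellFoundedLT W]
    [Nonempty K] {S : Set W} (hS : Cardinal.mk S < Order.cof K) (s : K → W → W)
    (hs : ∀ γ, Antitone fun k => s k γ) :
    ∃ k, ∀ k' ≥ k, ∀ γ ∈ S, s k' γ = s k γ := by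
  have h : ∀ γ, ∃ k, ∀ k', s k γ ≤ s k' γ := fun γ =>
    ⟨_, fun k' => (Function.argmin_le (fun k => s k γ) k')⟩
  choose g hg using h
  obtain ⟨k, hk⟩ := exists_forall_lt_of_mk_lt_cof (fun γ : S => g γ) hS
  refine ⟨k, fun k' hk' γ hγ => (hs γ hk').antisymm ?_⟩
  exact (hs γ (hk ⟨γ, hγ⟩).le).trans (hg γ k')

/-- **Club guessing.** If `cof W > θ⁺`, there is a family indexed by `W` of sets of size `θ`
without maximum such that every club of `W` contains a member of the family. -/
theorem exists_club_guessing {θ : Cardinal.{u}} (hθ : θ.IsRegular) {W : Type u}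
    [ConditionallyCompleteLinearOrderBot W] [WellFoundedLT W]
    (hW : Order.succ θ < Order.cof W) :
    ∃ C : W → Set W, ∀ D, IsClub D → ∃ α, C α ⊆ D ∧ Cardinal.mk (C α) = θ ∧
      ∀ t ∈ C α, ∃ t' ∈ C α, t < t' := by
  classical
  by_contra! H
  let ladder : W → Set W → Prop := fun α S =>
    S ⊆ Set.Iio α ∧ (∀ β < α, ∃ γ ∈ S, β ≤ γ) ∧ Cardinal.mk S ≤ θ
  let c : W → Set W := fun α => if h : ∃ S, ladder α S then h.choose else ∅
  let T : Set W → W → Set W := fun E α => (glue E '' c α) \ {⊥}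
  choose G hG using H
  let K := (Order.succ θ).ord.ToType
  have hθ' : (Order.succ θ).IsRegular := Cardinal.isRegular_succ hθ.aleph0_le
  have hK : Order.cof K = Order.succ θ := by
    rw [Ordinal.cof_toType, hθ'.cof_ord]
  have hWmax : NoMaxOrder W :=
    noMaxOrder_of_aleph0_le_cof (hθ'.aleph0_le.trans hW.le)
  have hKmax : NoMaxOrder K := noMaxOrder_of_aleph0_le_cof (hθ'.aleph0_le.trans hK.ge)
  have hKne : Nonempty K := Order.cof_ne_zero_iff.1 (hK.trans_ne hθ'.ne_zero)
  obtain ⟨E, hE⟩ := exists_wellFounded_rec (W := K) (β := Set W)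
    (fun r k => ⋂ j : Set.Iio k, G (T (r j))) fun r r' k h =>
      Set.iInter_congr fun j => by rw [h j j.2]
  have hEG : ∀ {j k}, j < k → E k ⊆ G (T (E j)) := fun {j k} h => by
    rw [hE k]
    exact Set.iInter_subset (fun j : Set.Iio k => G (T (E j))) ⟨j, h⟩
  have hEanti : Antitone E := fun j k hjk => by
    rw [hE j]
    exact Set.subset_iInter fun i => hEG (i.2.trans_le hjk)
  have hE' : IsClub (⋂ k, G (T (E k))) := by
    refine IsClub.iInter ?_ ?_ fun k => (hG (T (E k))).1
    · exact ((hθ.aleph0_le.trans_lt (Order.lt_succ θ)).trans hW).ne'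
    · simpa [K] using hW
  have hE'sub : ∀ k, (⋂ k, G (T (E k))) ⊆ E k := fun k => by
    rw [hE k]
    exact Set.subset_iInter fun j => Set.iInter_subset _ _
  set E' := ⋂ k, G (T (E k))
  let L := θ.ord.ToType
  have hL : Order.cof L = θ := by rw [Ordinal.cof_toType, hθ.cof_ord]
  have hLmax : NoMaxOrder L := noMaxOrder_of_aleph0_le_cof (hθ.aleph0_le.trans hL.ge)
  obtain ⟨e, he, heE⟩ : ∃ e : L → W, StrictMono e ∧ ∀ i, e i ∈ E' := by
    have h : Ordinal.type (α := L) (· < ·) ≤ Ordinal.type (α := E') (· < ·) := by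
      rw [Ordinal.type_toType, Cardinal.ord_le, Ordinal.card_type]
      exact ((Order.le_succ θ).trans hW.le).trans (Order.cof_le hE'.isCofinal)
    obtain ⟨g⟩ := Ordinal.type_le_iff.1 h
    exact ⟨fun i => g i, fun i j hij => g.map_rel_iff.2 hij, fun i => (g i).2⟩
  obtain ⟨b, hb⟩ := exists_forall_lt_of_mk_lt_cof e
    (by simpa [L] using (Order.lt_succ θ).trans hW)
  have hbdd : BddAbove (Set.range e) := ⟨b, by rintro _ ⟨i, rfl⟩; exact (hb i).le⟩
  have hLne : Nonempty L := Order.cof_ne_zero_iff.1 (hL.trans_ne hθ.ne_zero)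
  let α := ⨆ i, e i
  have heα : ∀ i, e i < α := fun i => by
    obtain ⟨j, hj⟩ := exists_gt i
    exact (he hj).trans_le (le_ciSup hbdd j)
  have hαe : ∀ β < α, ∃ i, β < e i := fun β hβ => exists_lt_of_lt_ciSup hβ
  have hc : ladder α (c α) := by
    have h : ∃ S, ladder α S := by
      refine ⟨Set.range e, ?_, fun β hβ => ?_, ?_⟩
      · rintro _ ⟨i, rfl⟩
        exact heα i
      · obtain ⟨i, hi⟩ := hαe β hβ
        exact ⟨_, ⟨i, rfl⟩, hi.le⟩
      · exact Cardinal.mk_range_le.trans (by simp [L])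
    simp only [c, dif_pos h]
    exact h.choose_spec
  obtain ⟨k, hk⟩ := exists_stable (K := K) (S := c α)
    (hc.2.2.trans_lt ((Order.lt_succ θ).trans_eq hK.symm)) (fun k => glue (E k))
    fun γ j k hjk => glue_mono (hEanti hjk) γ
  obtain ⟨k', hk'⟩ := exists_gt k
  have hT₁ : ∀ i, ∃ t ∈ T (E k) α, e i ≤ t := fun i => by
    obtain ⟨j, hj⟩ := exists_gt i
    obtain ⟨γ, hγ, hjγ⟩ := hc.2.1 _ (heα j)
    have h := le_glue (hE'sub k (heE j)) hjγ
    refine ⟨_, ⟨⟨γ, hγ, rfl⟩, ?_⟩, (he hj).le.trans h⟩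
    exact ((bot_le.trans_lt (he hj)).trans_le h).ne'
  have hT₂ : ∀ t ∈ T (E k) α, ∃ i, t < e i := by
    rintro _ ⟨⟨γ, hγ, rfl⟩, -⟩
    exact hαe _ ((glue_le _ _).trans_lt (hc.1 hγ))
  obtain ⟨t, ht, hmax⟩ := (hG (T (E k))).2 α (by
      rintro _ ⟨⟨γ, hγ, rfl⟩, hne⟩
      rw [Set.mem_singleton_iff, ← hk k' hk'.le γ hγ] at hne
      rw [← hk k' hk'.le γ hγ]
      exact glue_mem (hG _).1 (hEG hk') hne) (by
      refine le_antisymm ?_ (hL ▸ cof_le_mk_of_interleaved he hT₁ hT₂)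
      exact (Cardinal.mk_le_mk_of_subset Set.sdiff_subset).trans
        (Cardinal.mk_image_le.trans hc.2.2))
  obtain ⟨i, hi⟩ := hT₂ t ht
  obtain ⟨t', ht', hit'⟩ := hT₁ i
  exact (hmax t' ht').not_gt (hi.trans_le hit')

/-- A continuous increasing sequence of ordinals whose `w`-th term bounds a prescribed operation
`Φ` on the earlier terms. -/
theorem exists_continuous_seq {W : Type} [LinearOrder W] [WellFoundedLT W]
    (Φ : (W → Ordinal.{0}) → W → Ordinal.{0})
    (hΦ : ∀ r r' v, (∀ k ≤ v, r k = r' k) → Φ r v = Φ r' v) (hlt : ∀ r v, r v < Φ r v) :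
    ∃ ξ : W → Ordinal.{0}, StrictMono ξ ∧ (∀ w, ξ w = ⨆ v : Set.Iio w, Φ ξ v) ∧
      (∀ v w, v < w → Φ ξ v ≤ ξ w) ∧
      ∀ w, ∀ γ < ξ w, ∃ v < w, ∀ u > v, γ < ξ u := by
  obtain ⟨ξ, hξ⟩ := exists_wellFounded_rec (W := W) (β := Ordinal.{0})
    (fun r w => ⨆ v : Set.Iio w, Φ r v) fun r r' w h =>
      iSup_congr fun v => hΦ _ _ _ fun k hk => h k (hk.trans_lt v.2)
  have hle : ∀ v w, v < w → Φ ξ v ≤ ξ w := fun v w h => by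
    rw [hξ w]
    exact Ordinal.le_iSup (fun v : Set.Iio w => Φ ξ v) ⟨v, h⟩
  refine ⟨ξ, fun v w h => (hlt ξ v).trans_le (hle v w h), hξ, hle, fun w γ hγ => ?_⟩
  rw [hξ w, Ordinal.lt_iSup_iff] at hγ
  obtain ⟨v, hv⟩ := hγ
  exact ⟨v, v.2, fun u hu => hv.trans_le (hle v u hu)⟩

/-- The preimage of a club under a continuous increasing cofinal sequence is a club. -/
theorem isClub_preimage {W : Type} [ConditionallyCompleteLinearOrderBot W]
    (hW : Cardinal.aleph0 < Order.cof W) {ξ : W → Ordinal.{0}} (hξ : StrictMono ξ)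
    (hcont : ∀ w, ∀ γ < ξ w, ∃ v < w, ∀ u > v, γ < ξ u)
    {E : Set Ordinal.{0}} (hE : IsClubIn E (⨆ w, ξ w)) : IsClub {w | ξ w ∈ E} := by
  have hmax := noMaxOrder_of_aleph0_le_cof hW.le
  have hlt : ∀ w, ξ w < ⨆ w, ξ w := fun w => by
    obtain ⟨v, hv⟩ := exists_gt w
    exact (hξ hv).trans_le (Ordinal.le_iSup ξ v)
  have hlim : ∀ a, ∀ v < a, (∀ v < a, ∃ w > v, ∃ ε ∈ E, ξ w ≤ ε ∧ ε < ξ a) → ξ a ∈ E := by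
    intro a v hv h
    refine hE.2.2 _ (hlt a) ((zero_le (a := ξ v)).trans_lt (hξ hv)).ne' fun γ hγ => ?_
    obtain ⟨u, hu, huγ⟩ := hcont a γ hγ
    obtain ⟨w, hw, ε, hε, hwε, hεa⟩ := h u hu
    exact ⟨ε, hε, (huγ w hw).trans_le hwε, hεa⟩
  refine ⟨dirSupClosed_iff_of_linearOrder.2 fun d hd hne a ha => ?_, fun w₀ => ?_⟩
  · by_cases had : a ∈ d
    · exact hd had
    have hda : ∀ v ∈ d, v < a := fun v hv =>
      lt_of_le_of_ne (ha.1 hv) fun h => had (h ▸ hv)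
    obtain ⟨v₀, hv₀⟩ := hne
    refine hlim a v₀ (hda _ hv₀) fun v hv => ?_
    obtain ⟨w, hw, hvw⟩ := (lt_isLUB_iff ha).1 hv
    exact ⟨w, hvw, ξ w, hd hw, le_rfl, hξ (hda w hw)⟩
  · have hstep : ∀ w, ∃ w', ∃ ε ∈ E, ξ w ≤ ε ∧ ε < ξ w' := fun w => by
      obtain ⟨ε, hε, hwε⟩ := hE.2.1 _ (hlt w)
      obtain ⟨w', hw'⟩ := Ordinal.lt_iSup_iff.1 (hE.1 hε)
      exact ⟨w', ε, hε, hwε, hw'⟩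
    choose next hnext using hstep
    have hnext_lt : ∀ w, w < next w := fun w => by
      obtain ⟨ε, -, h₁, h₂⟩ := hnext w
      exact hξ.lt_iff_lt.1 (h₁.trans_lt h₂)
    let s : ℕ → W := fun n => next^[n] w₀
    have hs : ∀ n, s (n + 1) = next (s n) := fun n => Function.iterate_succ_apply' _ _ _
    have hsmono : StrictMono s := strictMono_nat_of_lt_succ fun n => by
      rw [hs]
      exact hnext_lt _
    obtain ⟨b, hb⟩ := exists_forall_lt_of_mk_lt_cof s (by simpa using hW)
    have hbdd : BddAbove (Set.range s) := ⟨b, by rintro _ ⟨n, rfl⟩; exact (hb n).le⟩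
    have hsa : ∀ n, s n < ⨆ n, s n := fun n =>
      (hsmono n.lt_succ_self).trans_le (le_ciSup hbdd _)
    refine ⟨⨆ n, s n, hlim _ _ (hsa 0) fun v hv => ?_, (hsa 0).le⟩
    obtain ⟨n, hn⟩ := exists_lt_of_lt_ciSup hv
    obtain ⟨ε, hε, h₁, h₂⟩ := hnext (s n)
    refine ⟨s n, hn, ε, hε, h₁, h₂.trans ?_⟩
    rw [← hs]
    exact hξ (hsa _)

/-- The pointwise supremum of the functions `f (r k)` for `k ∈ S`, `k ≤ v`. -/
def initialSup {W : Type} [LinearOrder W] (f : Ordinal.{0} → Ordinal.{0} → Ordinal.{0})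
    (S : Set W) (r : W → Ordinal.{0}) (v : W) (a : Ordinal.{0}) : Ordinal.{0} :=
  ⨆ k : {k // k ∈ S ∧ k ≤ v}, f (r k) a

theorem le_initialSup {W : Type} [LinearOrder W] (f : Ordinal.{0} → Ordinal.{0} → Ordinal.{0})
    {S : Set W} (r : W → Ordinal.{0}) {k v : W} (hk : k ∈ S) (h : k ≤ v) (a : Ordinal.{0}) :
    f (r k) a ≤ initialSup f S r v a :=
  Ordinal.le_iSup (fun k : {k // k ∈ S ∧ k ≤ v} => f (r k) a) ⟨k, hk, h⟩

/-- If `f (σ v)` dominates the earlier functions `f (ξ k)` modulo `I` and is dominated by the later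
ones, then the `f (σ v)` form a strongly increasing sequence. -/
theorem stronglyIncreasing_image {A : Set Ordinal.{0}} {I : Set (Set Ordinal.{0})}
    (hI : IsIdealOn A I) {f : Ordinal.{0} → Ordinal.{0} → Ordinal.{0}}
    {W : Type} [LinearOrder W] [WellFoundedLT W] {S : Set W} {ξ σ : W → Ordinal.{0}}
    (hσ : StrictMonoOn σ S) (hS : ∀ v ∈ S, ∃ u ∈ S, v < u)
    (h₁ : ∀ v ∈ S, ltI A I (initialSup f S ξ v) (f (σ v)))
    (h₂ : ∀ v ∈ S, ∀ u ∈ S, v < u → ltI A I (f (σ v)) (f (ξ u))) :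
    StronglyIncreasing A I (σ '' S) f := by
  have hnext : ∀ v ∈ S, ∃ u ∈ S, v < u ∧ ∀ w ∈ S, v < w → u ≤ w := fun v hv => by
    obtain ⟨u, hu⟩ := hS v hv
    obtain ⟨m, hm, hmin⟩ := WellFounded.has_min (wellFounded_lt (α := W))
      {u | u ∈ S ∧ v < u} ⟨u, hu⟩
    exact ⟨m, hm.1, hm.2, fun w hw hvw => not_lt.1 (hmin w ⟨hw, hvw⟩)⟩
  choose! next hnS hn hnle using hnext
  let Z : W → Set Ordinal.{0} := fun v =>
    {a | a ∈ A ∧ ¬ initialSup f S ξ v a < f (σ v) a} ∪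
      {a | a ∈ A ∧ ¬ f (σ v) a < f (ξ (next v)) a}
  have key : ∃ Z' : Ordinal.{0} → Set Ordinal.{0}, ∀ v ∈ S, Z' (σ v) = Z v := by
    refine ⟨fun β => ⋃ v : {v // v ∈ S ∧ σ v = β}, Z v, fun v hv => ?_⟩
    ext a
    simp only [Set.mem_iUnion]
    refine ⟨fun ⟨⟨u, hu, huv⟩, ha⟩ => hσ.injOn hu hv huv ▸ ha, fun ha => ⟨⟨v, hv, rfl⟩, ha⟩⟩
  obtain ⟨Z', hZ'⟩ := key
  refine ⟨Z', ?_, ?_⟩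
  · rintro _ ⟨v, hv, rfl⟩
    rw [hZ' v hv]
    exact hI.union_mem _ (h₁ v hv) _ (h₂ v hv _ (hnS v hv) (hn v hv))
  · rintro _ ⟨v, hv, rfl⟩ _ ⟨u, hu, rfl⟩ hvu a ⟨haA, haZ⟩
    rw [hZ' v hv, hZ' u hu] at haZ
    have hvu' : v < u := (hσ.lt_iff_lt hv hu).1 hvu
    have e₁ : f (σ v) a < f (ξ (next v)) a := by
      by_contra h
      exact haZ (Or.inl (Or.inr ⟨haA, h⟩))
    have e₂ : initialSup f S ξ u a < f (σ u) a := by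
      by_contra h
      exact haZ (Or.inr (Or.inl ⟨haA, h⟩))
    exact (e₁.trans_le (le_initialSup f ξ (hnS v hv) (hnle v hv u hu hvu') a)).trans e₂

theorem ltI_of_forall_le_of_ltI {A : Set Ordinal.{0}} {I : Set (Set Ordinal.{0})}
    (hI : IsIdealOn A I) {f g h : Ordinal.{0} → Ordinal.{0}} (hfg : ∀ a, f a ≤ g a)
    (hgh : ltI A I g h) : ltI A I f h :=
  hI.mem_of_subset _ hgh _ fun _ ha => ⟨ha.1, fun h' => ha.2 ((hfg _).trans_lt h')⟩

theorem ltI_trans {A : Set Ordinal.{0}} {I : Set (Set Ordinal.{0})}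
    (hI : IsIdealOn A I) {f g h : Ordinal.{0} → Ordinal.{0}} (hfg : ltI A I f g)
    (hgh : ltI A I g h) : ltI A I f h := by
  refine hI.mem_of_subset _ (hI.union_mem _ hfg _ hgh) _ fun a ⟨haA, ha⟩ => ?_
  by_cases h' : f a < g a
  · exact Or.inr ⟨haA, fun h'' => ha (h'.trans h'')⟩
  · exact Or.inl ⟨haA, h'⟩

/-- A supremum over `k ∈ S`, `k ≤ v` is at most the supremum over a set containing all `ξ k`. -/
theorem initialSup_le_iSup {W : Type} [LinearOrder W]
    (f : Ordinal.{0} → Ordinal.{0} → Ordinal.{0}) {S : Set W} {ξ : W → Ordinal.{0}}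
    {E : Set Ordinal.{0}} {δ : Ordinal.{0}} (hE : E ⊆ Set.Iio δ) (hS : ∀ k ∈ S, ξ k ∈ E) (v : W)
    (a : Ordinal.{0}) : initialSup f S ξ v a ≤ ⨆ α ∈ E, f α a := by
  have hsmall : Small.{0} E := small_subset hE
  have hbdd : BddAbove (Set.range fun α : Ordinal.{0} => ⨆ _ : α ∈ E, f α a) := by
    refine ⟨⨆ α : E, f α a, ?_⟩
    rintro _ ⟨α, rfl⟩
    exact ciSup_le' fun h => Ordinal.le_iSup (fun α : E => f α a) ⟨α, h⟩
  refine Ordinal.iSup_le fun k => ?_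
  refine le_trans ?_ (le_ciSup hbdd (ξ k))
  exact (ciSup_pos (f := fun _ : ξ k ∈ E => f (ξ k) a) (hS k k.2.1)).ge

/-- The club-domination criterion for cofinality `cof W > θ⁺`, where `W` is a well-order of size
`< λ` indexing the construction. -/
theorem star_of_index {A : Set Ordinal.{0}} {I : Set (Set Ordinal.{0})}
    (hI : IsIdealOn A I) {θ lam : Cardinal.{0}} (hθ : θ.IsRegular) (hlam : lam.IsRegular)
    {f : Ordinal.{0} → Ordinal.{0} → Ordinal.{0}} (hf : IncreasingModI A I lam.ord f)
    {W : Type} [ConditionallyCompleteLinearOrderBot W] [WellFoundedLT W]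
    (hcard : Cardinal.mk W < lam) (hcof : Order.succ θ < Order.cof W)
    (hclub : ∀ δ < lam.ord, Ordinal.cof δ = Order.cof W →
      ∃ E : Set Ordinal.{0}, IsClubIn E δ ∧ ∃ δ', δ ≤ δ' ∧ δ' < lam.ord ∧
        ltI A I (fun a => ⨆ α ∈ E, f α a) (f δ')) :
    Star A I lam.ord θ f := by
  classical
  intro X hX hXunb
  have haleph : Cardinal.aleph0 < Order.cof W :=
    hθ.aleph0_le.trans_lt ((Order.lt_succ θ).trans hcof)
  have hmax := noMaxOrder_of_aleph0_le_cof haleph.le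
  obtain ⟨C, hC⟩ := exists_club_guessing hθ hcof
  let P : (Ordinal.{0} → Ordinal.{0}) → Ordinal.{0} → Ordinal.{0} → Prop := fun h β s =>
    s ∈ X ∧ β ≤ s ∧ ltI A I h (f s)
  let σ : (Ordinal.{0} → Ordinal.{0}) → Ordinal.{0} → Ordinal.{0} := fun h β =>
    if hs : ∃ s, P h β s then hs.choose else β
  have hσ : ∀ h β, (∃ s, P h β s) → P h β (σ h β) := fun h β hs => by
    simp only [σ, dif_pos hs]
    exact hs.choose_spec
  have hσle : ∀ h β, β ≤ σ h β := fun h β => by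
    by_cases hs : ∃ s, P h β s
    · exact (hσ h β hs).2.1
    · simp only [σ, dif_neg hs, le_refl]
  have hσlt : ∀ h, ∀ β < lam.ord, σ h β < lam.ord := fun h β hβ => by
    by_cases hs : ∃ s, P h β s
    · exact hX (hσ h β hs).1
    · simpa only [σ, dif_neg hs] using hβ
  let Φ : (W → Ordinal.{0}) → W → Ordinal.{0} := fun r v =>
    ⨆ α : W, Order.succ (σ (initialSup f (C α) r v) (r v))
  have hσΦ : ∀ r v α, σ (initialSup f (C α) r v) (r v) < Φ r v := fun r v α =>
    (Order.lt_succ _).trans_le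
      (Ordinal.le_iSup (fun α : W => Order.succ (σ (initialSup f (C α) r v) (r v))) α)
  obtain ⟨ξ, hξ, hξeq, hΦξ, hcont⟩ := exists_continuous_seq Φ
    (fun r r' v h => iSup_congr fun α => by
      have : initialSup f (C α) r v = initialSup f (C α) r' v :=
        funext fun a => iSup_congr fun k => by rw [h k k.2.2]
      rw [this, h v le_rfl])
    fun r v => (hσle _ _).trans_lt (hσΦ r v v)
  have hlim : Order.IsSuccLimit lam.ord := Cardinal.isSuccLimit_ord hlam.aleph0_le
  have hξlam : ∀ w, ξ w < lam.ord := fun w => by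
    induction w using WellFoundedLT.induction with
    | ind w ih =>
      rw [hξeq w]
      refine Ordinal.iSup_lt_of_lt_cof ?_ fun v => Ordinal.iSup_lt_of_lt_cof ?_ fun α => ?_
      · rw [hlam.cof_ord]
        exact (Cardinal.mk_set_le _).trans_lt hcard
      · rwa [hlam.cof_ord]
      · exact hlim.succ_lt (hσlt _ _ (ih v v.2))
  obtain ⟨E, hE, δ', hδ, hδ', hEδ'⟩ := hclub (⨆ w, ξ w)
    (Ordinal.iSup_lt_of_lt_cof (by rwa [hlam.cof_ord]) hξlam) (Ordinal.cof_iSup hξ)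
  obtain ⟨α, hα, hαcard, hαmax⟩ := hC _ (isClub_preimage haleph hξ hcont hE)
  let τ : W → Ordinal.{0} := fun v => σ (initialSup f (C α) ξ v) (ξ v)
  have hτξ : ∀ v u, v < u → τ v < ξ u := fun v u h => (hσΦ ξ v α).trans_le (hΦξ v u h)
  have hτ : StrictMono τ := fun v u h => (hτξ v u h).trans_le (hσle _ _)
  have hτP : ∀ v, P (initialSup f (C α) ξ v) (ξ v) (τ v) := fun v => by
    refine hσ _ _ ?_
    obtain ⟨s, hs, hδs⟩ := hXunb _ (hlim.succ_lt hδ')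
    have hδs' : δ' < s := Order.succ_le_iff.1 hδs
    exact ⟨s, hs, ((Ordinal.le_iSup ξ v).trans hδ).trans hδs'.le,
      ltI_trans hI (ltI_of_forall_le_of_ltI hI (initialSup_le_iSup f hE.1 hα v) hEδ')
        (hf _ hδ' _ (hX hs) hδs')⟩
  refine ⟨τ '' C α, ?_, ?_, stronglyIncreasing_image hI (hτ.strictMonoOn _) hαmax
    (fun v _ => (hτP v).2.2) fun v _ u _ h => hf _ (hX (hτP v).1) _ (hξlam u) (hτξ v u h)⟩
  · rintro _ ⟨v, -, rfl⟩
    exact (hτP v).1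
  · rw [← hαcard]
    simpa using Cardinal.mk_image_eq_of_injOn_lift τ (C α) hτ.injective.injOn

/-- the club-domination criterion implies `(*)_θ`. -/
theorem star_of_club_domination (A : Set Ordinal.{0}) (I : Set (Set Ordinal.{0}))
    (hI : IsIdealOn A I) (θ lam : Cardinal.{0})
    (hθ : θ.IsRegular) (hlam : lam.IsRegular)
    (hsucc : Order.succ (Order.succ θ) < lam)
    (f : Ordinal.{0} → Ordinal.{0} → Ordinal.{0})
    (hf : IncreasingModI A I lam.ord f)
    (hclub : ∀ δ < lam.ord, Ordinal.cof δ = Order.succ (Order.succ θ) →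
      ∃ E : Set Ordinal.{0}, IsClubIn E δ ∧ ∃ δ', δ ≤ δ' ∧ δ' < lam.ord ∧
        ltI A I (fun a => ⨆ α ∈ E, f α a) (f δ')) :
    Star A I lam.ord θ f := by
  let W := (Order.succ (Order.succ θ)).ord.ToType
  have hW : (Order.succ (Order.succ θ)).IsRegular :=
    Cardinal.isRegular_succ (hθ.aleph0_le.trans (Order.le_succ θ))
  have hcof : Order.cof W = Order.succ (Order.succ θ) := by
    rw [Ordinal.cof_toType, hW.cof_ord]
  have : Nonempty W := Order.cof_ne_zero_iff.1 (hcof.trans_ne hW.ne_zero)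
  let := WellFoundedLT.toOrderBot (α := W)
  let := WellFoundedLT.conditionallyCompleteLinearOrderBot W
  exact star_of_index hI hθ hlam hf (W := W) (by simpa [W] using hsucc)
    ((Order.lt_succ _).trans_eq hcof.symm) (hcof ▸ hclub)

end PCFPaper
end
end

section
/- Let A be a set of regular cardinals and I an ideal on A with reg(I) < min(A). Let λ > reg(I) be a regular cardinal such that (∏A, ≤_I) is λ-directed, and let f⃗ = ⟨f_ξ : ξ < λ⟩ be any <_I-increasing sequence of functions in ∏A. Then there exists a sequence g⃗ = ⟨g_ξ : ξ < λ⟩ in ∏A such that: (1) g⃗ is <_I-increasing; (2) f_ξ(a) < g_{ξ+1}(a) for every ξ < λ and a ∈ A; and (3) for every regular cardinal θ < λ such that θ⁺⁺ < λ, {a ∈ A : a ≤ θ⁺⁺} ∈ I, and I is θ-regular, the sequence g⃗ satisfies Good_θ, i.e. g⃗ has an I-exact upper bound f with {a ∈ A : cf(f(a)) < θ} ∈ I. -/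
noncomputable section

namespace PCFPaper

open Set

variable (A : Set Ordinal.{0}) (I : Set (Set Ordinal.{0}))

section

open Cardinal Order

/-- Functional choice along the ordinals: a locally determined predicate `P ξ g` is satisfied by
`g ξ` whenever it is satisfied at all. -/
theorem exists_ordinal_rec {β : Type*} [Nonempty β]
    (P : Ordinal.{0} → (Ordinal.{0} → β) → β → Prop)
    (hloc : ∀ ξ φ ψ u, (∀ η < ξ, φ η = ψ η) → P ξ φ u → P ξ ψ u) :
    ∃ g : Ordinal.{0} → β, ∀ ξ, (∃ u, P ξ g u) → P ξ g (g ξ) := by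
  classical
  let d : β := Classical.arbitrary β
  let ext : (ξ : Ordinal.{0}) → ((η : Ordinal.{0}) → η < ξ → β) → Ordinal.{0} → β :=
    fun ξ prev η => if h : η < ξ then prev η h else d
  let G : (ξ : Ordinal.{0}) → ((η : Ordinal.{0}) → η < ξ → β) → β :=
    fun ξ prev => Classical.epsilon (P ξ (ext ξ prev))
  let g : Ordinal.{0} → β := WellFounded.fix (r := fun a b : Ordinal.{0} => a < b)
    Ordinal.lt_wf G
  have hg : ∀ ξ, g ξ = Classical.epsilon (P ξ (ext ξ fun η _ => g η)) := fun ξ =>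
    WellFounded.fix_eq Ordinal.lt_wf G ξ
  have hext : ∀ ξ, ∀ η < ξ, ext ξ (fun η _ => g η) η = g η := fun ξ η h => by simp [ext, h]
  refine ⟨g, fun ξ ⟨u, hu⟩ => ?_⟩
  have h := Classical.epsilon_spec
    (⟨u, hloc ξ _ _ u (fun η h => (hext ξ η h).symm) hu⟩ : ∃ v, P ξ (ext ξ fun η _ => g η) v)
  rw [← hg] at h
  exact hloc ξ _ _ _ (hext ξ) h

theorem exists_lt_forall_le {β : Type 1} {a : Ordinal.{0}} (f : β → Ordinal.{0})
    (hβ : #β < Cardinal.lift.{1} a.cof) (hf : ∀ i, f i < a) : ∃ b < a, ∀ i, f i ≤ b := by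
  by_contra! h
  have hc : IsCofinal (Set.range fun i : β => (⟨f i, hf i⟩ : Set.Iio a)) := by
    rintro ⟨b, hb⟩
    obtain ⟨i, hi⟩ := h b hb
    exact ⟨_, ⟨i, rfl⟩, hi.le⟩
  have h1 := (Order.cof_le hc).trans Cardinal.mk_range_le
  rw [Ordinal.cof_Iio, ← Ordinal.lift_cof] at h1
  exact absurd hβ h1.not_gt

/-- Recursive construction of normal functions, overtaking `T` at successors. -/
theorem exists_isNormal_rec (T : Ordinal.{0} → (Ordinal.{0} → Ordinal.{0}) → Ordinal.{0})
    (hT : ∀ j φ, φ j ≤ T j φ)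
    (hloc : ∀ j φ ψ, (∀ k ≤ j, φ k = ψ k) → T j φ = T j ψ) :
    ∃ x : Ordinal.{0} → Ordinal.{0}, Order.IsNormal x ∧ (∀ j, T j x < x (j + 1)) ∧
      ∀ a i, i.card < a.cof → (∀ j < i, (∀ k ≤ j, x k < a) → T j x < a) → x i < a := by
  obtain ⟨x, hx⟩ := exists_ordinal_rec
    (fun i φ u => u = ⨆ j : Set.Iio i, (T j φ + 1))
    (fun i φ ψ u h hu => by
      rw [hu]
      congr 1
      ext j
      rw [hloc j φ ψ fun k hk => h k (lt_of_le_of_lt hk j.2)])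
  replace hx : ∀ i, x i = ⨆ j : Set.Iio i, (T j x + 1) := fun i => hx i ⟨_, rfl⟩
  have hlt : ∀ i, ∀ j < i, T j x < x i := fun i j hj => by
    rw [hx i]
    exact Ordinal.lt_iSup_add_one (fun j : Set.Iio i => T j x) ⟨j, hj⟩
  have hmono : StrictMono x := fun j i hj => (hT j x).trans_lt (hlt i j hj)
  have hle : ∀ i b, (∀ j < i, T j x < b) → x i ≤ b := fun i b h => by
    rw [hx i]
    exact Ordinal.iSup_add_one_le fun j => h j j.2
  refine ⟨x, Order.isNormal_iff.2 ⟨hmono, fun o ho a h => ?_⟩, fun j => hlt _ j (by simp), ?_⟩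
  · refine hle o a fun j hj => ?_
    have hj' : j + 1 < o := ho.succ_lt hj
    exact (hlt _ j (by simp)).trans_le (h _ hj')
  · intro a i
    induction i using WellFoundedLT.induction with
    | ind i ih =>
      intro hi h
      have hxi : ∀ j < i, x j < a := fun j hj => ih j hj
        ((Ordinal.card_le_card hj.le).trans_lt hi) fun k hk => h k (hk.trans hj)
      have hTi : ∀ j < i, T j x < a := fun j hj => h j hj fun k hk => hxi k (hk.trans_lt hj)
      rcases eq_or_ne i 0 with rfl | hi0
      · refine (hle 0 0 (by simp)).trans_lt ?_
        rw [← Ordinal.cof_pos]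
        exact (zero_le).trans_lt hi
      · rw [hx i]
        refine Ordinal.lift_iSup_add_one_lt_of_lt_cof ?_ fun j => hTi j j.2
        rw [Cardinal.mk_Iio_ordinal, ← Ordinal.lift_cof, Cardinal.lift_id'.{0, 1}]
        exact Cardinal.lift_lt.2 hi

/-- `E` is closed and unbounded below `δ`. -/
structure ClubBelow (E : Set Ordinal.{0}) (δ : Ordinal.{0}) : Prop where
  unbounded : ∀ α < δ, ∃ β ∈ E, α < β ∧ β < δ
  closed : ∀ t ⊆ E, t.Nonempty → ∀ x < δ, IsLUB t x → x ∈ E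

theorem ClubBelow.isClub {E : Set Ordinal.{0}} {δ : Ordinal.{0}} (h : ClubBelow E δ) :
    IsClub {x : Set.Iio δ | x.1 ∈ E} := by
  refine ⟨fun d hd hne _ a ha => ?_, fun a => ?_⟩
  · refine h.closed (Subtype.val '' d) ?_ (hne.image _) a a.2 ⟨?_, ?_⟩
    · rintro _ ⟨y, hy, rfl⟩
      exact hd hy
    · rintro _ ⟨y, hy, rfl⟩
      exact ha.1 hy
    · intro b hb
      rcases lt_or_ge b δ with hbδ | hbδ
      · exact ha.2 (show (⟨b, hbδ⟩ : Set.Iio δ) ∈ upperBounds d from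
          fun y hy => hb ⟨y, hy, rfl⟩)
      · exact (le_of_lt a.2).trans hbδ
  · obtain ⟨β, hβ, h1, h2⟩ := h.unbounded a a.2
    exact ⟨⟨β, h2⟩, hβ, h1.le⟩

theorem ClubBelow.of_isClub {E : Set Ordinal.{0}} {δ : Ordinal.{0}} (hδ : IsSuccLimit δ)
    (h : IsClub {x : Set.Iio δ | x.1 ∈ E}) : ClubBelow E δ := by
  refine ⟨fun α hα => ?_, fun t ht hne x hx hlub => ?_⟩
  · obtain ⟨β, hβ, h1⟩ := h.isCofinal ⟨succ α, hδ.succ_lt hα⟩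
    exact ⟨β, hβ, (lt_succ α).trans_le h1, β.2⟩
  · refine h.isLUB_mem (t := {y : Set.Iio δ | y.1 ∈ t}) (x := ⟨x, hx⟩) (fun y hy => ht hy) ?_
      ⟨fun y hy => hlub.1 hy, fun b hb => ?_⟩
    · obtain ⟨y, hy⟩ := hne
      exact ⟨⟨y, (hlub.1 hy).trans_lt hx⟩, hy⟩
    · exact hlub.2 fun y hy => hb (show (⟨y, (hlub.1 hy).trans_lt hx⟩ : Set.Iio δ) ∈ _ from hy)

theorem ClubBelow.iInter {ι : Type 1} {E : ι → Set Ordinal.{0}} {δ : Ordinal.{0}}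
    (hδ : ℵ₀ < δ.cof) (hι : #ι < Cardinal.lift.{1} δ.cof) (h : ∀ i, ClubBelow (E i) δ) :
    ClubBelow (⋂ i, E i) δ := by
  refine .of_isClub (Ordinal.one_lt_cof_iff.1 (Cardinal.one_lt_aleph0.trans hδ)) ?_
  have hcof : Order.cof (Set.Iio δ) = Cardinal.lift.{1} δ.cof := by
    rw [Ordinal.cof_Iio, ← Ordinal.lift_cof]
  have := IsClub.iInter (f := fun i => {x : Set.Iio δ | x.1 ∈ E i})
    (by rw [hcof]; exact (Cardinal.aleph0_lt_lift.2 hδ).ne') (by rwa [hcof, Cardinal.lift_lt])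
    fun i => (h i).isClub
  convert this using 1
  ext x
  simp

theorem ClubBelow.inter {E F : Set Ordinal.{0}} {δ : Ordinal.{0}} (hδ : ℵ₀ < δ.cof)
    (hE : ClubBelow E δ) (hF : ClubBelow F δ) : ClubBelow (E ∩ F) δ := by
  refine .of_isClub (Ordinal.one_lt_cof_iff.1 (Cardinal.one_lt_aleph0.trans hδ)) ?_
  refine hE.isClub.inter ?_ hF.isClub
  rw [Ordinal.cof_Iio, ← Ordinal.lift_cof]
  exact (Cardinal.aleph0_lt_lift.2 hδ).ne'

theorem _root_.Order.IsNormal.clubBelow_range {x : Ordinal.{0} → Ordinal.{0}}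
    (hx : Order.IsNormal x) {o : Ordinal.{0}} (ho : IsSuccLimit o) :
    ClubBelow (Set.range x) (x o) := by
  refine ⟨fun α hα => ?_, fun t ht hne y _ hy =>
    hx.dirSupClosed_range ht hne (.of_linearOrder _) hy⟩
  obtain ⟨i, hi, h⟩ := (hx.lt_iff_exists_lt ho).1 hα
  exact ⟨x i, ⟨i, rfl⟩, h, hx.strictMono hi⟩

theorem ClubBelow.preimage {x : Ordinal.{0} → Ordinal.{0}} (hx : Order.IsNormal x)
    {o : Ordinal.{0}} (ho : IsSuccLimit o) (hcof : ℵ₀ < o.cof) {E : Set Ordinal.{0}}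
    (hE : ClubBelow E (x o)) : ClubBelow (x ⁻¹' E) o := by
  refine ⟨fun α hα => ?_, fun t ht hne y hy hlub => ?_⟩
  · obtain ⟨_, ⟨h1, ⟨i, rfl⟩⟩, h2, h3⟩ :=
      (hE.inter (by rwa [Ordinal.cof_map_of_isNormal hx ho]) (hx.clubBelow_range ho)).unbounded
        (x α) (hx.strictMono hα)
    exact ⟨i, h1, hx.strictMono.lt_iff_lt.1 h2, hx.strictMono.lt_iff_lt.1 h3⟩
  · refine hE.closed (x '' t) ?_ (hne.image _) _ (hx.strictMono hy) (hx.map_isLUB hlub hne)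
    rintro _ ⟨z, hz, rfl⟩
    exact ht hz

theorem exists_clubBelow_card_le (δ : Ordinal.{0}) : ∃ E : Set Ordinal.{0}, E ⊆ Set.Iio δ ∧
    #E ≤ Cardinal.lift.{1} δ.cof ∧ (IsSuccLimit δ → ClubBelow E δ) := by
  classical
  by_cases hδ : IsSuccLimit δ
  swap
  · exact ⟨∅, by simp, by simp, fun h => absurd h hδ⟩
  have ho : IsSuccLimit δ.cof.ord :=
    Cardinal.isSuccLimit_ord (Ordinal.aleph0_le_cof_iff.2 (Ordinal.one_lt_cof_iff.2 hδ))
  obtain ⟨f', hf1, hf2⟩ : ∃ f' : Ordinal.{0} → Ordinal.{0}, (∀ j < δ.cof.ord, f' j < δ) ∧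
      ∀ b < δ, ∃ j < δ.cof.ord, b ≤ f' j := by
    obtain ⟨f, hf⟩ := Ordinal.exists_isFundamentalSeq (o := δ) rfl
    refine ⟨fun j => if h : j ∈ Set.Iio δ.cof.ord then (f ⟨j, h⟩).1 else 0, fun j hj => ?_,
      fun b hb => ?_⟩
    · beta_reduce
      rw [dif_pos (Set.mem_Iio.2 hj)]
      exact (f _).2
    · obtain ⟨_, ⟨i, rfl⟩, hi⟩ := hf.isCofinal_range ⟨b, hb⟩
      refine ⟨i.1, i.2, ?_⟩
      beta_reduce
      rw [dif_pos i.2]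
      exact Subtype.coe_le_coe.2 hi
  set o := δ.cof.ord with ho_def
  obtain ⟨x, hx, hTx, hxlt⟩ := exists_isNormal_rec
    (fun j φ => if j < o then max (φ j) (f' j) else φ j)
    (fun j φ => by split_ifs <;> simp)
    (fun j φ ψ h => by simp [h j le_rfl])
  have hxδ : ∀ i < o, x i < δ := fun i hi => by
    refine hxlt δ i (Cardinal.lt_ord.1 hi) fun j hj h => ?_
    rw [if_pos (hj.trans hi)]
    exact max_lt (h j le_rfl) (hf1 j (hj.trans hi))
  have hxo : x o = δ := by
    refine le_antisymm ((hx.le_iff_forall_le ho).2 fun i hi => (hxδ i hi).le) ?_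
    refine le_of_forall_lt fun b hb => ?_
    obtain ⟨i, hi, hbi⟩ := hf2 b hb
    have h1 := hTx i
    rw [if_pos hi] at h1
    exact (hbi.trans_lt ((le_max_right _ _).trans_lt h1)).trans
      (hx.strictMono (show i + 1 < o from ho.succ_lt hi))
  have hclub := hx.clubBelow_range ho
  rw [hxo] at hclub
  refine ⟨x '' Set.Iio o, ?_, ?_, fun _ => ⟨fun α hα => ?_, fun t ht hne y hy hlub => ?_⟩⟩
  · rintro _ ⟨i, hi, rfl⟩
    exact hxδ i hi
  · refine Cardinal.mk_image_le.trans ?_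
    rw [Cardinal.mk_Iio_ordinal, ho_def, Cardinal.card_ord]
  · obtain ⟨_, ⟨i, rfl⟩, h1, h2⟩ := hclub.unbounded α hα
    exact ⟨x i, ⟨i, hx.strictMono.lt_iff_lt.1 (by rwa [hxo]), rfl⟩, h1, h2⟩
  · obtain ⟨i, rfl⟩ := hclub.closed t (ht.trans (Set.image_subset_range _ _)) hne y hy hlub
    exact ⟨i, hx.strictMono.lt_iff_lt.1 (by rwa [hxo]), rfl⟩

theorem exists_subset_Iio_card_eq_cof (α : Ordinal.{0}) : ∃ c ⊆ Set.Iio α,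
    (∀ b < α, ∃ γ ∈ c, b ≤ γ) ∧ #c = Cardinal.lift.{1} α.cof := by
  obtain ⟨s, hs, hs'⟩ := Order.exists_cof_eq (Set.Iio α)
  refine ⟨Subtype.val '' s, ?_, fun b hb => ?_, ?_⟩
  · rintro _ ⟨y, -, rfl⟩
    exact y.2
  · obtain ⟨y, hy, hby⟩ := hs ⟨b, hb⟩
    exact ⟨y, ⟨y, hy, rfl⟩, hby⟩
  · rw [Cardinal.mk_image_eq Subtype.val_injective, hs', Ordinal.cof_Iio, ← Ordinal.lift_cof]

/-- Club guessing at `θ⁺⁺` for sets of size `θ`. -/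
theorem exists_clubGuessing {θ : Cardinal.{0}} (hθ : θ.IsRegular) :
    ∃ C : Ordinal.{0} → Set Ordinal.{0}, ∀ E, ClubBelow E (succ (succ θ)).ord →
      ∃ α < (succ (succ θ)).ord, C α ⊆ E ∧ #(C α) = Cardinal.lift.{1} θ ∧
        ∀ i ∈ C α, i < (succ (succ θ)).ord ∧ ∃ j ∈ C α, i < j := by
  classical
  set M := (succ (succ θ)).ord with hM
  have hθ' : (succ θ).IsRegular := Cardinal.isRegular_succ hθ.aleph0_le
  have hμ : (succ (succ θ)).IsRegular := Cardinal.isRegular_succ hθ'.aleph0_le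
  have hcofM : M.cof = succ (succ θ) := hμ.cof_ord
  have hM0 : ℵ₀ < M.cof := by
    rw [hcofM]
    exact hθ'.aleph0_le.trans_lt (lt_succ _)
  by_contra! hcon
  choose c hcα hcc hcard using exists_subset_Iio_card_eq_cof
  let s : Set Ordinal.{0} → Ordinal.{0} → Ordinal.{0} := fun E γ => sSup (E ∩ Set.Iic γ)
  have hbdd : ∀ (E : Set Ordinal.{0}) γ, BddAbove (E ∩ Set.Iic γ) := fun E γ =>
    ⟨γ, fun y hy => hy.2⟩
  have hsle : ∀ E γ, s E γ ≤ γ := fun E γ => csSup_le' fun y hy => hy.2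
  have hsmono : ∀ E F, E ⊆ F → ∀ γ, s E γ ≤ s F γ := fun E F h γ =>
    csSup_le_csSup' (hbdd F γ) (Set.inter_subset_inter_left _ h)
  let gl : Set Ordinal.{0} → Ordinal.{0} → Set Ordinal.{0} := fun E α =>
    {y | y ≠ 0 ∧ ∃ γ ∈ c α, s E γ = y}
  choose star hstar hstar' using fun E => hcon (gl E)
  obtain ⟨D, hD⟩ := exists_ordinal_rec (β := Set Ordinal.{0})
    (fun i φ u => u = ⋂ j : Set.Iio i, star (φ j))
    (fun i φ ψ u h hu => by
      rw [hu]
      exact Set.iInter_congr fun j => by rw [h j j.2])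
  replace hD : ∀ i, D i = ⋂ j : Set.Iio i, star (D j) := fun i => hD i ⟨_, rfl⟩
  have hDanti : Antitone D := fun i j hij => by
    rw [hD i, hD j]
    exact Set.subset_iInter fun k => Set.iInter_subset_of_subset
      (⟨k.1, k.2.trans_le hij⟩ : Set.Iio j) subset_rfl
  have hDstar : ∀ i, D (i + 1) ⊆ star (D i) := fun i => by
    rw [hD (i + 1)]
    exact Set.iInter_subset_of_subset (⟨i, by simp⟩ : Set.Iio (i + 1)) subset_rfl
  have hDclub : ∀ i ≤ (succ θ).ord, ClubBelow (D i) M := fun i hi => by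
    rw [hD i]
    refine .iInter hM0 ?_ fun j => hstar _
    rw [Cardinal.mk_Iio_ordinal, Cardinal.lift_lt, hcofM]
    refine (Ordinal.card_le_card hi).trans_lt ?_
    rw [Cardinal.card_ord]
    exact lt_succ _
  choose! nx hnxD hnx hnxM using (hDclub _ le_rfl).unbounded
  obtain ⟨x, hx, hTx, hxlt⟩ := exists_isNormal_rec
    (fun j φ => if φ j < M then nx (φ j) else φ j)
    (fun j φ => by
      split_ifs with h
      · exact (hnx _ h).le
      · exact le_rfl)
    (fun j φ ψ h => by rw [h j le_rfl])
  have hθlim : IsSuccLimit θ.ord := Cardinal.isSuccLimit_ord hθ.aleph0_le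
  set α := x θ.ord with hα
  have hαM : α < M := by
    refine hxlt M _ ?_ fun j _ h => ?_
    · rw [Cardinal.card_ord, hcofM]
      exact (lt_succ _).trans (lt_succ _)
    · rw [if_pos (h j le_rfl)]
      exact hnxM _ (h j le_rfl)
  have hαcof : α.cof = θ := by rw [hα, Ordinal.cof_map_of_isNormal hx hθlim, hθ.cof_ord]
  have hunb : ∀ b < α, ∃ e ∈ D (succ θ).ord, b < e ∧ e < α := fun b hb => by
    obtain ⟨i, hi, hbi⟩ := (hx.lt_iff_exists_lt hθlim).1 hb
    have hiα : x i < α := hx.strictMono hi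
    have h1 := hTx i
    rw [if_pos (hiα.trans hαM)] at h1
    exact ⟨_, hnxD _ (hiα.trans hαM), hbi.trans (hnx _ (hiα.trans hαM)),
      h1.trans (hx.strictMono (show i + 1 < θ.ord from hθlim.succ_lt hi))⟩
  have hκlim : IsSuccLimit (succ θ).ord := Cardinal.isSuccLimit_ord hθ'.aleph0_le
  have hstab : ∀ γ : c α, ∃ i < (succ θ).ord, ∀ j < (succ θ).ord, s (D i) γ ≤ s (D j) γ := by
    intro γ
    have hne : ((fun i => s (D i) γ) '' Set.Iio (succ θ).ord).Nonempty :=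
      ⟨_, 0, hκlim.bot_lt, rfl⟩
    obtain ⟨i, hi, h⟩ := csInf_mem hne
    exact ⟨i, hi, fun j hj => h.trans_le (csInf_le' ⟨j, hj, rfl⟩)⟩
  choose ig hig hig' using hstab
  obtain ⟨i, hi, hii⟩ := exists_lt_forall_le ig (a := (succ θ).ord)
    (by rw [hcard, hαcof, hθ'.cof_ord, Cardinal.lift_lt]; exact lt_succ _) hig
  have hi1 : i + 1 < (succ θ).ord := hκlim.succ_lt hi
  have heq : ∀ γ ∈ c α, s (D i) γ = s (D (i + 1)) γ := fun γ hγ =>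
    le_antisymm ((hsmono _ _ (hDanti (hii ⟨γ, hγ⟩)) γ).trans (hig' ⟨γ, hγ⟩ _ hi1))
      (hsmono _ _ (hDanti (by simp)) γ)
  have hglα : gl (D i) α ⊆ Set.Iio α := by
    rintro _ ⟨-, γ, hγ, rfl⟩
    exact (hsle _ _).trans_lt (hcα α hγ)
  have hglunb : ∀ b < α, ∃ y ∈ gl (D i) α, b < y := fun b hb => by
    obtain ⟨e, he, hbe, heα⟩ := hunb b hb
    obtain ⟨γ, hγ, heγ⟩ := hcc α e heα
    have h1 : e ≤ s (D i) γ := le_csSup (hbdd _ _) ⟨hDanti hi.le he, heγ⟩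
    exact ⟨_, ⟨((zero_le).trans_lt (hbe.trans_le h1)).ne', γ, hγ, rfl⟩, hbe.trans_le h1⟩
  have hsub : gl (D i) α ⊆ star (D i) := by
    rintro y ⟨hy0, γ, hγ, rfl⟩
    rw [heq γ hγ] at hy0 ⊢
    refine hDstar i ((hDclub _ hi1.le).closed (D (i + 1) ∩ Set.Iic γ) Set.inter_subset_left ?_ _
      ((hsle _ _).trans_lt ((hcα α hγ).trans hαM)) (isLUB_csSup ?_ (hbdd _ _)))
    all_goals
      refine Set.nonempty_iff_ne_empty.2 fun h => hy0 ?_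
      simp only [s, h, csSup_empty, Ordinal.bot_eq_zero]
  have hglcard : #(gl (D i) α) = Cardinal.lift.{1} θ := by
    refine le_antisymm ?_ ?_
    · refine (Cardinal.mk_le_mk_of_subset (t := s (D i) '' c α) ?_).trans
        (Cardinal.mk_image_le.trans ?_)
      · rintro _ ⟨-, γ, hγ, rfl⟩
        exact ⟨γ, hγ, rfl⟩
      · rw [hcard, hαcof]
    · have hcf : IsCofinal {z : Set.Iio α | z.1 ∈ gl (D i) α} := fun b => by
        obtain ⟨z, hz, hbz⟩ := hglunb b b.2
        exact ⟨⟨z, hglα hz⟩, hz, hbz.le⟩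
      have h1 := Order.cof_le hcf
      rw [Ordinal.cof_Iio, ← Ordinal.lift_cof, hαcof] at h1
      exact h1.trans (Cardinal.mk_preimage_of_injective _ _ Subtype.val_injective)
  obtain ⟨y, hy, hymax⟩ := hstar' (D i) α hαM hsub hglcard
  obtain ⟨z, hz, hyz⟩ := hglunb y (hglα hy)
  exact (hymax ((hglα hy).trans hαM) z hz).not_gt hyz

variable {A I}

theorem IsIdealOn.mem_of_subset_union (hI : IsIdealOn A I) {X Y Z : Set Ordinal.{0}} (hX : X ∈ I)
    (hY : Y ∈ I) (h : Z ⊆ X ∪ Y) : Z ∈ I :=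
  hI.mem_of_subset _ (hI.union_mem _ hX _ hY) _ h

theorem IsIdealOn.leI_of_forall (hI : IsIdealOn A I) {f g : Ordinal.{0} → Ordinal.{0}}
    (h : ∀ a ∈ A, f a ≤ g a) : leI A I f g :=
  hI.mem_of_subset _ hI.empty_mem _ fun a ha => absurd (h a ha.1) ha.2

theorem IsIdealOn.leI_of_ltI (hI : IsIdealOn A I) {f g : Ordinal.{0} → Ordinal.{0}}
    (h : ltI A I f g) : leI A I f g :=
  hI.mem_of_subset _ h _ fun _ ha => ⟨ha.1, fun h => ha.2 h.le⟩

theorem IsIdealOn.leI_trans (hI : IsIdealOn A I) {f g h : Ordinal.{0} → Ordinal.{0}}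
    (hfg : leI A I f g) (hgh : leI A I g h) : leI A I f h :=
  hI.mem_of_subset_union hfg hgh fun a ha => by
    by_contra hc
    simp only [Set.mem_union, Set.mem_ofPred_eq, not_or, not_and, not_not] at hc
    exact ha.2 ((hc.1 ha.1).trans (hc.2 ha.1))

theorem IsIdealOn.ltI_of_leI_of_ltI (hI : IsIdealOn A I) {f g h : Ordinal.{0} → Ordinal.{0}}
    (hfg : leI A I f g) (hgh : ltI A I g h) : ltI A I f h :=
  hI.mem_of_subset_union hfg hgh fun a ha => by
    by_contra hc
    simp only [Set.mem_union, Set.mem_ofPred_eq, not_or, not_and, not_not] at hc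
    exact ha.2 ((hc.1 ha.1).trans_lt (hc.2 ha.1))

theorem IsIdealOn.ltI_of_ltI_of_leI (hI : IsIdealOn A I) {f g h : Ordinal.{0} → Ordinal.{0}}
    (hfg : ltI A I f g) (hgh : leI A I g h) : ltI A I f h :=
  hI.mem_of_subset_union hfg hgh fun a ha => by
    by_contra hc
    simp only [Set.mem_union, Set.mem_ofPred_eq, not_or, not_and, not_not] at hc
    exact ha.2 ((hc.1 ha.1).trans_le (hc.2 ha.1))

theorem IncreasingModI.leI (hI : IsIdealOn A I) {μ : Ordinal.{0}}
    {g : Ordinal.{0} → Ordinal.{0} → Ordinal.{0}} (hg : IncreasingModI A I μ g)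
    {ξ η : Ordinal.{0}} (h : ξ ≤ η) (hη : η < μ) : leI A I (g ξ) (g η) := by
  rcases h.eq_or_lt with rfl | h
  · exact hI.leI_of_forall fun _ _ => le_rfl
  · exact hI.leI_of_ltI (hg ξ (h.trans hη) η hη h)

/-- Refinement of a sequence in `∏ A` which, at limit stages `δ`, dominates everywhere above
`cf δ` the terms along a club subset of `δ`. -/
theorem exists_increasing_clubwise_dominating (hI : IsIdealOn A I) (hA : IsRegularCardSet A)
    {lam : Cardinal.{0}} (hlam : lam.IsRegular) (hdir : DirectedMod A I lam)
    {f : Ordinal.{0} → Ordinal.{0} → Ordinal.{0}} (hfprod : ∀ ξ < lam.ord, f ξ ∈ prodSet A) :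
    ∃ g : Ordinal.{0} → Ordinal.{0} → Ordinal.{0}, (∀ ξ < lam.ord, g ξ ∈ prodSet A) ∧
      IncreasingModI A I lam.ord g ∧ (∀ ξ < lam.ord, ∀ a ∈ A, f ξ a < g (ξ + 1) a) ∧
      ∀ δ < lam.ord, IsSuccLimit δ → ∃ E, ClubBelow E δ ∧
        ∀ a ∈ A, δ.cof.ord < a → ∀ ε ∈ E, g ε a ≤ g δ a := by
  classical
  choose E hEδ hEcard hEclub using exists_clubBelow_card_le
  have hAlim : ∀ a ∈ A, IsSuccLimit a := fun a ha => by
    obtain ⟨c, hc, rfl⟩ := hA a ha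
    exact Cardinal.isSuccLimit_ord hc.aleph0_le
  obtain ⟨g, hg⟩ := exists_ordinal_rec (β := Ordinal.{0} → Ordinal.{0})
    (fun ξ φ u => u ∈ prodSet A ∧ (∀ η < ξ, ltI A I (φ η) u) ∧
      (∀ η, ξ = η + 1 → ∀ a ∈ A, f η a < u a) ∧
      ∀ a ∈ A, ξ.cof.ord < a → ∀ ε ∈ E ξ, φ ε a ≤ u a)
    (fun ξ φ ψ u h hu => ⟨hu.1, fun η hη => h η hη ▸ hu.2.1 η hη, hu.2.2.1,
      fun a ha hξa ε hε => h ε (hEδ ξ hε) ▸ hu.2.2.2 a ha hξa ε hε⟩)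
  have key : ∀ ξ < lam.ord, g ξ ∈ prodSet A ∧ (∀ η < ξ, ltI A I (g η) (g ξ)) ∧
      (∀ η, ξ = η + 1 → ∀ a ∈ A, f η a < g ξ a) ∧
      ∀ a ∈ A, ξ.cof.ord < a → ∀ ε ∈ E ξ, g ε a ≤ g ξ a := by
    intro ξ
    induction ξ using WellFoundedLT.induction with
    | ind ξ ih =>
      intro hξ
      refine hg ξ ?_
      obtain ⟨b, hb, hgb⟩ := hdir (g '' Set.Iio ξ)
        (by
          rintro _ ⟨η, hη, rfl⟩
          exact (ih η hη (hη.trans hξ)).1)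
        (Cardinal.mk_image_le.trans_lt (by
          rw [Cardinal.mk_Iio_ordinal, Cardinal.lift_lt]
          exact Cardinal.lt_ord.1 hξ))
      obtain ⟨p, hp, hfp⟩ : ∃ p ∈ prodSet A, ∀ η, ξ = η + 1 → ∀ a ∈ A, f η a ≤ p a := by
        by_cases h : ∃ η, ξ = η + 1
        · obtain ⟨η, rfl⟩ := h
          have hη : η < lam.ord := lt_trans (by simp) hξ
          refine ⟨f η, hfprod η hη, fun η' h a _ => ?_⟩
          rw [← Order.succ_eq_add_one, ← Order.succ_eq_add_one] at h
          rw [Order.succ_injective h]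
        · exact ⟨b, hb, fun η hη => absurd ⟨η, hη⟩ h⟩
      have he : ∀ a ∈ A, ∃ e < a, ξ.cof.ord < a → ∀ ε ∈ E ξ, g ε a ≤ e := fun a ha => by
        by_cases h : ξ.cof.ord < a
        · obtain ⟨c, hc, rfl⟩ := hA a ha
          obtain ⟨e, he, h'⟩ := exists_lt_forall_le (a := c.ord) (fun ε : E ξ => g ε c.ord)
            ((hEcard ξ).trans_lt (by
              rw [hc.cof_ord, Cardinal.lift_lt]
              exact Cardinal.ord_lt_ord.1 h))
            fun ε => (ih ε (hEδ ξ ε.2) ((hEδ ξ ε.2).trans hξ)).1 _ ha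
          exact ⟨e, he, fun _ ε hε => h' ⟨ε, hε⟩⟩
        · exact ⟨b a, hb a ha, fun h' => absurd h' h⟩
      choose! e he he' using he
      refine ⟨fun a => max (max (b a) (p a) + 1) (e a), fun a ha => ?_, fun η hη => ?_,
        fun η hη a ha => ?_, fun a ha hξa ε hε => ?_⟩
      · exact max_lt ((hAlim a ha).succ_lt (max_lt (hb a ha) (hp a ha))) (he a ha)
      · refine hI.mem_of_subset _ (hgb _ ⟨η, hη, rfl⟩) _ fun a ha => ⟨ha.1, fun h => ha.2 ?_⟩
        exact (h.trans (le_max_left _ _)).trans_lt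
          ((Order.lt_add_one_iff.2 le_rfl).trans_le (le_max_left _ _))
      · exact ((hfp η hη a ha).trans (le_max_right _ _)).trans_lt
          ((Order.lt_add_one_iff.2 le_rfl).trans_le (le_max_left _ _))
      · exact (he' a ha hξa ε hε).trans (le_max_right _ _)
  have hlim : IsSuccLimit lam.ord := Cardinal.isSuccLimit_ord hlam.aleph0_le
  exact ⟨g, fun ξ hξ => (key ξ hξ).1, fun ξ _ η hη h => (key η hη).2.1 ξ h,
    fun ξ hξ => (key _ (hlim.succ_lt hξ)).2.2.1 ξ rfl,
    fun δ hδ hδl => ⟨E δ, hEclub δ hδl, (key δ hδ).2.2.2⟩⟩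

theorem ThetaRegular.exists_mem {θ : Cardinal.{0}} (hθ : θ ≠ 0) (h : ThetaRegular A I θ)
    {ι : Type 1} (hι : #ι = Cardinal.lift.{1} θ) (B : ι → Set Ordinal.{0})
    (hB : ∀ i, IsPositive A I (B i)) :
    ∃ H : Set ι, #H = Cardinal.lift.{1} θ ∧ ∃ a ∈ A, ∀ i ∈ H, a ∈ B i := by
  classical
  obtain ⟨e⟩ : Nonempty (Set.Iio θ.ord ≃ ι) := by
    rw [← Cardinal.eq, hι, Cardinal.mk_Iio_ordinal, Cardinal.card_ord]
  obtain ⟨H, hH, hHcard, a, ha⟩ := h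
    (fun i => if h : i ∈ Set.Iio θ.ord then B (e ⟨i, h⟩) else ∅) fun i hi => by
      rw [dif_pos (Set.mem_Iio.2 hi)]
      exact hB _
  replace ha : ∀ i, ∀ hi : i ∈ H, a ∈ B (e ⟨i, hH hi⟩) := fun i hi => by
    have := Set.mem_iInter₂.1 ha i hi
    rwa [dif_pos (hH hi)] at this
  refine ⟨Set.range fun i : H => e ⟨i, hH i.2⟩, ?_, a, ?_, ?_⟩
  · rw [Cardinal.mk_range_eq _ fun i j hij => by simpa [Subtype.ext_iff] using hij, hHcard]
  · obtain ⟨i, hi⟩ : H.Nonempty := by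
      rw [Set.nonempty_iff_ne_empty]
      rintro rfl
      rw [Cardinal.mk_eq_zero, eq_comm, Cardinal.lift_eq_zero] at hHcard
      exact hθ hHcard
    exact (hB _).1 (ha i hi)
  · rintro _ ⟨i, rfl⟩
    exact ha i i.2

/-- The pointwise least element of `S a` above `f a`. -/
def projAbove (S : Ordinal.{0} → Set Ordinal.{0}) (f : Ordinal.{0} → Ordinal.{0}) :
    Ordinal.{0} → Ordinal.{0} :=
  fun a => sInf (S a ∩ Set.Ici (f a))

section projAbove

variable {S T : Ordinal.{0} → Set Ordinal.{0}} {f g : Ordinal.{0} → Ordinal.{0}} {a b : Ordinal.{0}}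

theorem projAbove_le (hb : b ∈ S a) (h : f a ≤ b) : projAbove S f a ≤ b :=
  csInf_le' ⟨hb, h⟩

theorem projAbove_mem (hb : b ∈ S a) (h : f a ≤ b) : projAbove S f a ∈ S a :=
  (csInf_mem (s := S a ∩ Set.Ici (f a)) ⟨b, hb, h⟩).1

theorem le_projAbove (hb : b ∈ S a) (h : f a ≤ b) : f a ≤ projAbove S f a :=
  (csInf_mem (s := S a ∩ Set.Ici (f a)) ⟨b, hb, h⟩).2

theorem projAbove_mono (hb : b ∈ S a) (h : g a ≤ b) (hfg : f a ≤ g a) :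
    projAbove S f a ≤ projAbove S g a :=
  projAbove_le (projAbove_mem hb h) (hfg.trans (le_projAbove hb h))

theorem projAbove_anti (hST : S a ⊆ T a) (hb : b ∈ S a) (h : f a ≤ b) :
    projAbove T f a ≤ projAbove S f a :=
  projAbove_le (hST (projAbove_mem hb h)) (le_projAbove hb h)

end projAbove

/-- If the terms along clubs are dominated, some pointwise projection to small sets `S a` of a term
of the sequence bounds the whole sequence. -/
theorem exists_projAbove_isUBseq (hI : IsIdealOn A I) {lam : Cardinal.{0}} (hlam : lam.IsRegular)
    {g : Ordinal.{0} → Ordinal.{0} → Ordinal.{0}} (hgprod : ∀ ξ < lam.ord, g ξ ∈ prodSet A)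
    (hg : IncreasingModI A I lam.ord g)
    (hdom : ∀ δ < lam.ord, IsSuccLimit δ → ∃ E, ClubBelow E δ ∧
      ∀ a ∈ A, δ.cof.ord < a → ∀ ε ∈ E, g ε a ≤ g δ a)
    {θ : Cardinal.{0}} (hθ : θ.IsRegular) (hθlam : succ (succ θ) < lam)
    (hsmall : {a | a ∈ A ∧ a ≤ (succ (succ θ)).ord} ∈ I) (hreg : ThetaRegular A I θ)
    {S : Ordinal.{0} → Set Ordinal.{0}} (hS : ∀ a ∈ A, #(S a) < Cardinal.lift.{1} θ)
    (haS : ∀ a ∈ A, a ∈ S a) :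
    ∃ ξ < lam.ord, IsUBseq A I lam.ord g (projAbove S (g ξ)) := by
  classical
  by_contra! hcon
  replace hcon : ∀ ξ < lam.ord, ∃ η < lam.ord, ¬ leI A I (g η) (projAbove S (g ξ)) :=
    fun ξ hξ => by
      have := hcon ξ hξ
      simp only [IsUBseq] at this
      push Not at this
      exact this
  obtain ⟨C, hC⟩ := exists_clubGuessing hθ
  set M := (succ (succ θ)).ord with hM
  have hμ : (succ (succ θ)).IsRegular :=
    Cardinal.isRegular_succ (Cardinal.isRegular_succ hθ.aleph0_le).aleph0_le
  have hMlim : IsSuccLimit M := Cardinal.isSuccLimit_ord hμ.aleph0_le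
  have hM0 : ℵ₀ < M.cof := by
    rw [hμ.cof_ord]
    exact (Cardinal.isRegular_succ hθ.aleph0_le).aleph0_le.trans_lt (lt_succ _)
  let Dom : Ordinal.{0} → Ordinal.{0} → (Ordinal.{0} → Ordinal.{0}) → Ordinal.{0} → Prop :=
    fun α j φ σ => {a | a ∈ A ∧ ∃ k ∈ C α, k ≤ j ∧ ¬ g (φ k) a ≤ g σ a} ∈ I
  let Q : Ordinal.{0} → (Ordinal.{0} → Ordinal.{0}) → Ordinal.{0} → Prop := fun j φ ζ =>
    φ j ≤ ζ ∧ ζ < lam.ord ∧ ∃ σ < lam.ord, ¬ leI A I (g ζ) (projAbove S (g σ)) ∧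
      ∀ α < M, (∃ ρ < lam.ord, Dom α j φ ρ) → Dom α j φ σ
  have hQ : ∀ j φ, φ j < lam.ord → ∃ ζ, Q j φ ζ := fun j φ hφ => by
    have : ∀ α : Set.Iio M, ∃ ρ < lam.ord, (∃ ρ < lam.ord, Dom α j φ ρ) → Dom α j φ ρ :=
      fun α => by
        by_cases h : ∃ ρ < lam.ord, Dom α j φ ρ
        · obtain ⟨ρ, h1, h2⟩ := h
          exact ⟨ρ, h1, fun _ => h2⟩
        · exact ⟨φ j, hφ, fun h' => absurd h' h⟩
    choose ρ hρ hρ' using this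
    obtain ⟨σ, hσ, hρσ⟩ := exists_lt_forall_le (a := lam.ord) ρ
      (by rwa [Cardinal.mk_Iio_ordinal, hlam.cof_ord, Cardinal.lift_lt, Cardinal.card_ord]) hρ
    obtain ⟨η, hη, hση⟩ := hcon σ hσ
    refine ⟨max (φ j) η, le_max_left _ _, max_lt hφ hη, σ, hσ, fun h => hση ?_, fun α hα h => ?_⟩
    · exact hI.leI_trans (hg.leI hI (le_max_right _ _) (max_lt hφ hη)) h
    · refine hI.mem_of_subset_union (hρ' ⟨α, hα⟩ h) (hg.leI hI (hρσ ⟨α, hα⟩) hσ) ?_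
      rintro a ⟨ha, k, hk, hkj, hka⟩
      by_contra hc
      simp only [Set.mem_union, Set.mem_ofPred_eq, not_or, not_and, not_not, not_exists] at hc
      exact hka ((hc.1 ha k hk hkj).trans (hc.2 ha))
  obtain ⟨x, hx, hTx, hxlt⟩ := exists_isNormal_rec
    (fun j φ => if ∃ ζ, Q j φ ζ then Classical.epsilon (Q j φ) else φ j)
    (fun j φ => by
      split_ifs with h
      · exact (Classical.epsilon_spec h).1
      · exact le_rfl)
    (fun j φ ψ h => by
      have hDom : ∀ α, Dom α j φ = Dom α j ψ := fun α => by
        ext σ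
        have : {a | a ∈ A ∧ ∃ k ∈ C α, k ≤ j ∧ ¬ g (φ k) a ≤ g σ a} =
            {a | a ∈ A ∧ ∃ k ∈ C α, k ≤ j ∧ ¬ g (ψ k) a ≤ g σ a} := by
          ext a
          refine and_congr_right fun _ => exists_congr fun k => and_congr_right fun _ =>
            and_congr_right fun hk => by rw [h k hk]
        simp only [Dom, this]
      have : Q j φ = Q j ψ := by
        ext ζ
        simp only [Q, hDom, h j le_rfl]
      rw [this, h j le_rfl])
  have hxlam : ∀ i ≤ M, x i < lam.ord := fun i hi => by
    refine hxlt _ i ?_ fun j _ h => ?_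
    · rw [hlam.cof_ord]
      refine (Ordinal.card_le_card hi).trans_lt ?_
      rwa [Cardinal.card_ord]
    · rw [if_pos (hQ j x (h j le_rfl))]
      exact (Classical.epsilon_spec (hQ j x (h j le_rfl))).2.1
  have hstep : ∀ j < M, ∃ ζ < x (j + 1), Q j x ζ := fun j hj => by
    have h := hTx j
    rw [if_pos (hQ j x (hxlam j hj.le))] at h
    exact ⟨_, h, Classical.epsilon_spec (hQ j x (hxlam j hj.le))⟩
  obtain ⟨E, hE, hEdom⟩ := hdom (x M) (hxlam M le_rfl) (hx.map_isSuccLimit hMlim)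
  rw [Ordinal.cof_map_of_isNormal hx hMlim, hμ.cof_ord] at hEdom
  obtain ⟨α, hα, hCE, hCcard, hCM⟩ := hC _ (hE.preimage hx hMlim hM0)
  have hpos : ∀ i : C α, ∃ σ < lam.ord, ∃ s ∈ C α, (∀ k ∈ C α, i < k → s ≤ k) ∧
      IsPositive A I {a | a ∈ A ∧ projAbove S (g σ) a < g (x s) a ∧
        ∀ k ∈ C α, k ≤ i → g (x k) a ≤ g σ a} := by
    rintro ⟨i, hi⟩
    obtain ⟨ζ, hζ, -, hζlam, σ, hσ, hσζ, hσdom⟩ := hstep i (hCM i hi).1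
    have hne : (C α ∩ Set.Ioi i).Nonempty := (hCM i hi).2
    refine ⟨σ, hσ, sInf (C α ∩ Set.Ioi i), (csInf_mem hne).1,
      fun k hk hik => csInf_le' ⟨hk, hik⟩, fun a ha => ha.1, fun hcon => hσζ ?_⟩
    have hs : i < sInf (C α ∩ Set.Ioi i) := (csInf_mem hne).2
    have hsM : sInf (C α ∩ Set.Ioi i) < M := (hCM _ (csInf_mem hne).1).1
    have h1 : leI A I (g ζ) (g (x (sInf (C α ∩ Set.Ioi i)))) :=
      hg.leI hI (hζ.le.trans (hx.strictMono.monotone (Order.add_one_le_iff.2 hs))) (hxlam _ hsM.le)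
    have h2 : Dom α i x σ := hσdom α hα ⟨x M, hxlam M le_rfl,
      hI.mem_of_subset _ hsmall _ fun a ⟨ha, k, hk, _, hka⟩ =>
        ⟨ha, not_lt.1 fun h => hka (hEdom a ha h _ (hCE hk))⟩⟩
    refine hI.mem_of_subset_union (hI.union_mem _ h1 _ h2) hcon ?_
    rintro a ⟨ha, h3⟩
    by_contra hc
    simp only [Set.mem_union, Set.mem_ofPred_eq, not_or, not_and, not_not, not_exists] at hc
    exact hc.2 ha ((not_le.1 h3).trans_le (hc.1.1 ha)) fun k hk hki => hc.1.2 ha k hk hki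
  choose σ hσ s hs hsmin hspos using hpos
  obtain ⟨H, hH, a, ha, haH⟩ := hreg.exists_mem hθ.ne_zero hCcard _ hspos
  have hlt : ∀ i ∈ H, ∀ k ∈ H, i < k → projAbove S (g (σ i)) a < projAbove S (g (σ k)) a :=
    fun i hi k hk hik => (haH i hi).2.1.trans_le
      (((haH k hk).2.2 _ (hs i) (hsmin i k k.2 hik)).trans
        (le_projAbove (haS a ha) (hgprod _ (hσ k) a ha).le))
  have hinj : Function.Injective fun i : H => (⟨projAbove S (g (σ i)) a,
      projAbove_mem (haS a ha) (hgprod _ (hσ i) a ha).le⟩ : S a) := fun i k h => by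
    replace h := congrArg Subtype.val h
    rcases lt_trichotomy i k with h' | h' | h'
    · exact absurd h (hlt i i.2 k k.2 h').ne
    · exact h'
    · exact absurd h (hlt k k.2 i i.2 h').ne'
  have := Cardinal.mk_le_of_injective hinj
  rw [hH] at this
  exact (hS a ha).not_ge this

theorem exists_isLUBseq_of_isUBseq_projAbove (hI : IsIdealOn A I) {lam : Cardinal.{0}}
    (hlam : lam.IsRegular) {g : Ordinal.{0} → Ordinal.{0} → Ordinal.{0}}
    (hgprod : ∀ ξ < lam.ord, g ξ ∈ prodSet A) (hg : IncreasingModI A I lam.ord g)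
    {θ : Cardinal.{0}} (hθ : θ.IsRegular) (hθlam : θ < lam) (hreg : ThetaRegular A I θ)
    (hproj : ∀ S : Ordinal.{0} → Set Ordinal.{0}, (∀ a ∈ A, #(S a) < Cardinal.lift.{1} θ) →
      (∀ a ∈ A, a ∈ S a) → ∃ ξ < lam.ord, IsUBseq A I lam.ord g (projAbove S (g ξ))) :
    ∃ u, IsLUBseq A I lam.ord g u := by
  by_contra! hcon
  simp only [IsLUBseq] at hcon
  push Not at hcon
  have hθlim : IsSuccLimit θ.ord := Cardinal.isSuccLimit_ord hθ.aleph0_le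
  let S : Ordinal.{0} → (Ordinal.{0} → Ordinal.{0} → Ordinal.{0}) → Ordinal.{0} →
    Set Ordinal.{0} := fun α φ a => insert a ((fun β => φ β a) '' Set.Iio α)
  have hSa : ∀ α φ a, a ∈ S α φ a := fun α φ a => Set.mem_insert _ _
  have hScard : ∀ α < θ.ord, ∀ φ a, #(S α φ a) < Cardinal.lift.{1} θ := fun α hα φ a => by
    refine Cardinal.mk_insert_le.trans_lt (Cardinal.add_lt_of_lt
      (Cardinal.aleph0_le_lift.2 hθ.aleph0_le) (Cardinal.mk_image_le.trans_lt ?_)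
      (Cardinal.one_lt_aleph0.trans_le (Cardinal.aleph0_le_lift.2 hθ.aleph0_le)))
    rw [Cardinal.mk_Iio_ordinal, Cardinal.lift_lt]
    exact Cardinal.lt_ord.1 hα
  obtain ⟨u, hu⟩ := exists_ordinal_rec (β := Ordinal.{0} → Ordinal.{0})
    (fun α φ v => IsUBseq A I lam.ord g v ∧
      ∃ ξ < lam.ord, ¬ leI A I (projAbove (S α φ) (g ξ)) v)
    (fun α φ ψ v h hv => by
      have : S α φ = S α ψ := funext fun a => congrArg (insert a)
        (Set.image_congr fun β hβ => by rw [h β hβ])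
      rwa [← this])
  replace hu : ∀ α : Set.Iio θ.ord, IsUBseq A I lam.ord g (u α) ∧
      ∃ ξ < lam.ord, ¬ leI A I (projAbove (S α u) (g ξ)) (u α) := fun α => by
    refine hu α ?_
    obtain ⟨ξ, hξ, h⟩ := hproj (S α u) (fun a _ => hScard α α.2 u a) fun a _ => hSa α u a
    obtain ⟨v, hv, hv'⟩ := hcon _ h
    exact ⟨v, hv, ξ, hξ, hv'⟩
  choose hub ξ hξ hξu using hu
  obtain ⟨η, hη, hξη⟩ := exists_lt_forall_le (a := lam.ord) ξ
    (by rwa [Cardinal.mk_Iio_ordinal, hlam.cof_ord, Cardinal.lift_lt, Cardinal.card_ord]) hξ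
  have hanti : ∀ α β, α ≤ β → ∀ a ∈ A, projAbove (S β u) (g η) a ≤ projAbove (S α u) (g η) a :=
    fun α β h a ha => projAbove_anti
      (Set.insert_subset_insert (Set.image_mono (Set.Iio_subset_Iio h))) (hSa α u a)
      (hgprod η hη a ha).le
  have hpos : ∀ α : Set.Iio θ.ord, IsPositive A I
      {a | a ∈ A ∧ projAbove (S (α + 1) u) (g η) a < projAbove (S α u) (g η) a} := fun α => by
    refine ⟨fun a ha => ha.1, fun h => hξu α (hI.mem_of_subset_union h
      (hI.union_mem _ (hub α η hη) _ (hg.leI hI (hξη α) hη)) ?_)⟩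
    rintro a ⟨ha, hlt⟩
    by_contra hc
    simp only [Set.mem_union, Set.mem_ofPred_eq, not_or, not_and, not_not] at hc
    refine hc.1 ha ?_
    have hmem : u α a ∈ S (α + 1) u a :=
      Set.mem_insert_of_mem _ ⟨α, Set.mem_Iio.2 (Order.lt_add_one_iff.2 le_rfl), rfl⟩
    exact (projAbove_le hmem (hc.2.1 ha)).trans_lt ((not_le.1 hlt).trans_le
      (projAbove_mono (hSa α u a) (hgprod η hη a ha).le (hc.2.2 ha)))
  obtain ⟨H, hH, a, ha, haH⟩ := hreg.exists_mem hθ.ne_zero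
    (by rw [Cardinal.mk_Iio_ordinal, Cardinal.card_ord]) _ hpos
  have hlt : StrictAnti fun α : H => projAbove (S α u) (g η) a := fun α β h =>
    (hanti _ _ (Order.add_one_le_iff.2 h) a ha).trans_lt (haH α α.2).2
  have : WellFoundedGT H := hlt.wellFoundedGT
  have hfin : Finite H := Finite.of_wellFoundedLT_wellFoundedGT H
  have h1 := Cardinal.lt_aleph0_of_finite H
  rw [hH] at h1
  exact (Cardinal.aleph0_le_lift.2 hθ.aleph0_le).not_gt h1

theorem GoodAt.of_isUBseq_projAbove (hI : IsIdealOn A I) {lam : Cardinal.{0}}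
    (hlam : lam.IsRegular) {g : Ordinal.{0} → Ordinal.{0} → Ordinal.{0}}
    (hgprod : ∀ ξ < lam.ord, g ξ ∈ prodSet A) (hg : IncreasingModI A I lam.ord g)
    {θ : Cardinal.{0}} (hθ : θ.IsRegular) (hθlam : θ < lam) (hreg : ThetaRegular A I θ)
    (hproj : ∀ S : Ordinal.{0} → Set Ordinal.{0}, (∀ a ∈ A, #(S a) < Cardinal.lift.{1} θ) →
      (∀ a ∈ A, a ∈ S a) → ∃ ξ < lam.ord, IsUBseq A I lam.ord g (projAbove S (g ξ))) :
    GoodAt A I lam.ord g θ := by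
  classical
  obtain ⟨u, hu⟩ := exists_isLUBseq_of_isUBseq_projAbove hI hlam hgprod hg hθ hθlam hreg hproj
  have hθ1 : ∀ c < Cardinal.lift.{1} θ, c + 1 < Cardinal.lift.{1} θ := fun c hc =>
    Cardinal.add_lt_of_lt (Cardinal.aleph0_le_lift.2 hθ.aleph0_le) hc
      (Cardinal.one_lt_aleph0.trans_le (Cardinal.aleph0_le_lift.2 hθ.aleph0_le))
  refine ⟨u, ⟨hu, fun h hh => ?_⟩, ?_⟩
  · obtain ⟨ξ, hξ, hub⟩ := hproj (fun a => {h a, a})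
      (fun a _ => Cardinal.mk_insert_le.trans_lt (hθ1 _ (by
        rw [Cardinal.mk_singleton]
        exact Cardinal.one_lt_aleph0.trans_le (Cardinal.aleph0_le_lift.2 hθ.aleph0_le))))
      fun a _ => by simp
    refine ⟨ξ, hξ, hI.mem_of_subset _ (hI.ltI_of_ltI_of_leI hh (hu.2 _ hub)) _ ?_⟩
    rintro a ⟨ha, hlt⟩
    exact ⟨ha, (projAbove_le (by simp) (not_le.1 hlt).le).not_gt⟩
  · choose c hcb hcc hcard using exists_subset_Iio_card_eq_cof
    obtain ⟨ξ, hξ, hub⟩ := hproj (fun a => insert a (if (u a).cof < θ then c (u a) else ∅))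
      (fun a _ => Cardinal.mk_insert_le.trans_lt (hθ1 _ (by
        split_ifs with h
        · rwa [hcard, Cardinal.lift_lt]
        · rw [Cardinal.mk_eq_zero, ← Cardinal.lift_zero.{0, 1}, Cardinal.lift_lt]
          exact hθ.pos)))
      fun a _ => Set.mem_insert _ _
    have hlim : IsSuccLimit lam.ord := Cardinal.isSuccLimit_ord hlam.aleph0_le
    have hξ1 : ξ + 1 < lam.ord := hlim.succ_lt hξ
    refine hI.mem_of_subset_union (hI.ltI_of_ltI_of_leI
      (hg ξ hξ _ hξ1 (Order.lt_add_one_iff.2 le_rfl)) (hu.1 _ hξ1)) (hu.2 _ hub) ?_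
    rintro a ⟨ha, hcof⟩
    by_contra hcon
    simp only [Set.mem_union, Set.mem_ofPred_eq, not_or, not_and, not_not] at hcon
    obtain ⟨e, he, hge⟩ := hcc (u a) _ (hcon.1 ha)
    refine (hcon.2 ha).not_gt (lt_of_le_of_lt (projAbove_le ?_ hge) (hcb _ he))
    rw [if_pos hcof]
    exact Set.mem_insert_of_mem _ he

end

/-- construction of sequences that are `Good_θ` for all appropriate `θ`. -/
theorem good_sequences_exist (A : Set Ordinal.{0}) (I : Set (Set Ordinal.{0}))
    (hI : IsIdealOn A I) (hA : IsRegularCardSet A)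
    (hmin : (regI A I).ord < sInf A)
    (lam : Cardinal.{0}) (hlam : lam.IsRegular) (hreglam : regI A I < lam)
    (hdir : DirectedMod A I lam)
    (f : Ordinal.{0} → Ordinal.{0} → Ordinal.{0})
    (hfprod : ∀ ξ < lam.ord, f ξ ∈ prodSet A)
    (hf : IncreasingModI A I lam.ord f) :
    ∃ g : Ordinal.{0} → Ordinal.{0} → Ordinal.{0},
      (∀ ξ < lam.ord, g ξ ∈ prodSet A) ∧
      IncreasingModI A I lam.ord g ∧
      (∀ ξ < lam.ord, ∀ a ∈ A, f ξ a < g (ξ + 1) a) ∧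
      (∀ θ : Cardinal.{0}, θ.IsRegular → θ < lam →
        Order.succ (Order.succ θ) < lam →
        {a | a ∈ A ∧ a ≤ (Order.succ (Order.succ θ)).ord} ∈ I →
        ThetaRegular A I θ →
        GoodAt A I lam.ord g θ) := by
  obtain ⟨g, hgprod, hg, hfg, hdom⟩ :=
    exists_increasing_clubwise_dominating hI hA hlam hdir hfprod
  exact ⟨g, hgprod, hg, hfg, fun θ hθ hθlam hθlam' hsmall hreg =>
    GoodAt.of_isUBseq_projAbove hI hlam hgprod hg hθ hθlam hreg fun S hS haS =>
      exists_projAbove_isUBseq hI hlam hgprod hg hdom hθ hθlam' hsmall hreg hS haS⟩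

end PCFPaper
end
end
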